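/- arXiv:1702.07555 — 2 statements merged into one kernel-verified Lean document; each statement's English description precedes it below -/
import Mathlib

section
/- If a point set P in general position admits a spoke set of size k, then the edge set of the complete geometric graph on P can be covered by n − k crossing-free (plane) spanning trees, where n = |P|; in particular every set of n points admits such a covering with n − √(n/8) trees. -/
/-- The line { p | a x + b y = c } given by a triple (a, b, c). -/
def lineOf (l : ℝ × ℝ × ℝ) : Set (ℝ × ℝ) :=
  {p | l.1 * p.1 + l.2.1 * p.2 = l.2.2}

/-- Signed side value of a point with respect to a line (a, b, c). -/
def sideVal (l : ℝ × ℝ × ℝ) (p : ℝ × ℝ) : ℝ :=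
  l.1 * p.1 + l.2.1 * p.2 - l.2.2

/-- The union of the lines of an arrangement. -/
def linesUnion (S : Finset (ℝ × ℝ × ℝ)) : Set (ℝ × ℝ) :=
  ⋃ l ∈ S, lineOf l

/-- An unbounded region of a line arrangement: an unbounded connected component
of the complement of the union of the lines. -/
def IsUnboundedRegion (S : Finset (ℝ × ℝ × ℝ)) (U : Set (ℝ × ℝ)) : Prop :=
  (∃ p ∈ (linesUnion S)ᶜ, U = connectedComponentIn (linesUnion S)ᶜ p) ∧
  ¬ Bornology.IsBounded U

/-- A spoke set for P: a set of pairwise non-parallel lines such that every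
unbounded region of the arrangement contains a point of P. -/
def SpokeSet (P : Finset (ℝ × ℝ)) (S : Finset (ℝ × ℝ × ℝ)) : Prop :=
  (∀ l ∈ S, (l.1, l.2.1) ≠ (0, 0)) ∧
  (∀ l ∈ S, ∀ m ∈ S, l ≠ m → l.1 * m.2.1 - l.2.1 * m.1 ≠ 0) ∧
  (∀ U, IsUnboundedRegion S U → ∃ p ∈ P, (p : ℝ × ℝ) ∈ U)

/-- General position: no three distinct points collinear. -/
def GenPos (P : Set (ℝ × ℝ)) : Prop :=
  ∀ p ∈ P, ∀ q ∈ P, ∀ r ∈ P, p ≠ q → p ≠ r → q ≠ r → ¬ Collinear ℝ {p, q, r}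

/-- A avoids B: no line through two distinct points of A meets the convex hull of B. -/
def Avoids (A B : Finset (ℝ × ℝ)) : Prop :=
  ∀ a₁ ∈ A, ∀ a₂ ∈ A, a₁ ≠ a₂ →
    ∀ x ∈ (affineSpan ℝ {a₁, a₂} : Set (ℝ × ℝ)), x ∉ convexHull ℝ (B : Set (ℝ × ℝ))

/-- A and B can be separated by a line (A strictly on one side, B on the other). -/
def SeparatedByLine (A B : Finset (ℝ × ℝ)) : Prop :=
  ∃ l : ℝ × ℝ × ℝ, (l.1, l.2.1) ≠ (0, 0) ∧
    (∀ a ∈ A, sideVal l a < 0) ∧ (∀ b ∈ B, 0 < sideVal l b)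

/-- The supporting line of the segment from p to q. -/
def suppLine (p q : ℝ × ℝ) : Set (ℝ × ℝ) := (affineSpan ℝ {p, q} : Set (ℝ × ℝ))

/-- Two segments cross: the (unique) intersection point of their supporting
lines lies in both segments. -/
def SegCross (p₁ p₂ q₁ q₂ : ℝ × ℝ) : Prop :=
  ∃ s, suppLine p₁ p₂ ∩ suppLine q₁ q₂ = {s} ∧
    s ∈ segment ℝ p₁ p₂ ∧ s ∈ segment ℝ q₁ q₂

/-- The segment (p₁,p₂) stabs the segment (q₁,q₂): the intersection point of the
supporting lines lies in (q₁,q₂) but not in (p₁,p₂). -/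
def SegStabs (p₁ p₂ q₁ q₂ : ℝ × ℝ) : Prop :=
  ∃ s, suppLine p₁ p₂ ∩ suppLine q₁ q₂ = {s} ∧
    s ∈ segment ℝ q₁ q₂ ∧ s ∉ segment ℝ p₁ p₂

/-- Two segments are parallel: every common point of the supporting lines lies
in neither segment (this also covers parallel supporting lines). -/
def SegParallel (p₁ p₂ q₁ q₂ : ℝ × ℝ) : Prop :=
  ∀ s ∈ suppLine p₁ p₂ ∩ suppLine q₁ q₂,
    s ∉ segment ℝ p₁ p₂ ∧ s ∉ segment ℝ q₁ q₂

/-- v is the stabbing vertex of (p₁,p₂) with respect to (q₁,q₂): (p₁,p₂) stabs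
(q₁,q₂) and v is the endpoint of (p₁,p₂) closer to the intersection point. -/
def StabVertex (p₁ p₂ q₁ q₂ v : ℝ × ℝ) : Prop :=
  ∃ s, suppLine p₁ p₂ ∩ suppLine q₁ q₂ = {s} ∧
    s ∈ segment ℝ q₁ q₂ ∧ s ∉ segment ℝ p₁ p₂ ∧
    ((v = p₁ ∧ dist p₁ s ≤ dist p₂ s) ∨ (v = p₂ ∧ dist p₂ s ≤ dist p₁ s))

/-- Two unbounded regions are antipodal: they lie strictly on opposite sides
of every line of the arrangement. -/
def AntipodalRegions (S : Finset (ℝ × ℝ × ℝ)) (U V : Set (ℝ × ℝ)) : Prop :=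
  IsUnboundedRegion S U ∧ IsUnboundedRegion S V ∧
  ∀ l ∈ S, ∀ u ∈ U, ∀ v ∈ V, sideVal l u * sideVal l v < 0

/-- The endpoints of the edges of a matching. -/
noncomputable def endpoints (M : Finset ((ℝ × ℝ) × (ℝ × ℝ))) : Finset (ℝ × ℝ) :=
  M.image Prod.fst ∪ M.image Prod.snd

/-- M is the spoke matching of the spoke set S for P: its endpoints are points
of P, each unbounded region of the arrangement of S contains exactly one
endpoint of M, and each edge of M joins points in antipodal regions. -/
def SpokeMatching (P : Finset (ℝ × ℝ)) (S : Finset (ℝ × ℝ × ℝ))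
    (M : Finset ((ℝ × ℝ) × (ℝ × ℝ))) : Prop :=
  SpokeSet P S ∧
  (∀ e ∈ M, e.1 ∈ P ∧ e.2 ∈ P) ∧
  (∀ U, IsUnboundedRegion S U → ∃! p, p ∈ endpoints M ∧ p ∈ U) ∧
  (∀ e ∈ M, ∃ U V, AntipodalRegions S U V ∧ e.1 ∈ U ∧ e.2 ∈ V)


/-- An edge set forming a crossing-free (plane) spanning tree on P. -/
def IsPlaneSpanningTree (P : Finset (ℝ × ℝ)) (E : Finset ((ℝ × ℝ) × (ℝ × ℝ))) : Prop :=
  (∀ e ∈ E, e.1 ∈ P ∧ e.2 ∈ P ∧ e.1 ≠ e.2) ∧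
  E.card = P.card - 1 ∧
  (∀ p ∈ P, ∀ q ∈ P,
    Relation.ReflTransGen (fun x y => (x, y) ∈ E ∨ (y, x) ∈ E) p q) ∧
  (∀ e ∈ E, ∀ f ∈ E, e ≠ f →
    ∀ x, x ∈ openSegment ℝ e.1 e.2 → x ∉ openSegment ℝ f.1 f.2)

/-- A covering of the complete geometric graph on P by plane spanning trees. -/
def CoversCompleteGraph (P : Finset (ℝ × ℝ))
    (T : Finset (Finset ((ℝ × ℝ) × (ℝ × ℝ)))) : Prop :=
  (∀ E ∈ T, IsPlaneSpanningTree P E) ∧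
  ∀ p ∈ P, ∀ q ∈ P, p ≠ q → ∃ E ∈ T, (p, q) ∈ E ∨ (q, p) ∈ E


def orient (p q r : ℝ × ℝ) : ℝ :=
  (q.1 - p.1) * (r.2 - p.2) - (q.2 - p.2) * (r.1 - p.1)

theorem collinear_of_smul (p q r : ℝ × ℝ) (t : ℝ) (h1 : r.1 = p.1 + t * (q.1 - p.1))
    (h2 : r.2 = p.2 + t * (q.2 - p.2)) : Collinear ℝ {p, q, r} := by
  rw [collinear_iff_of_mem (p₀ := p) (by simp)]
  refine ⟨q - p, ?_⟩
  intro x hx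
  simp only [Set.mem_insert_iff, Set.mem_singleton_iff] at hx
  rcases hx with rfl | rfl | rfl
  · exact ⟨0, by simp⟩
  · exact ⟨1, by simp⟩
  · refine ⟨t, ?_⟩
    apply Prod.ext
    · simp [h1]; ring
    · simp [h2]; ring

theorem orient_ne_zero {P : Set (ℝ × ℝ)} (hg : GenPos P) {p q r : ℝ × ℝ} (hp : p ∈ P)
    (hq : q ∈ P) (hr : r ∈ P) (h1 : p ≠ q) (h2 : p ≠ r) (h3 : q ≠ r) : orient p q r ≠ 0 := by
  intro h
  apply hg p hp q hq r hr h1 h2 h3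
  unfold orient at h
  by_cases hx : q.1 - p.1 = 0
  · have hy : q.2 - p.2 ≠ 0 := by
      intro hy
      exact h1 (Prod.ext (by linarith) (by linarith))
    rw [hx] at h
    have hr1 : r.1 - p.1 = 0 := by
      have : (q.2 - p.2) * (r.1 - p.1) = 0 := by linarith
      exact (mul_eq_zero.mp this).resolve_left hy
    refine collinear_of_smul p q r ((r.2 - p.2) / (q.2 - p.2)) ?_ ?_
    · rw [hx]; linarith
    · field_simp; ring
  · refine collinear_of_smul p q r ((r.1 - p.1) / (q.1 - p.1)) ?_ ?_
    · field_simp; ring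
    · field_simp; linarith

theorem apex_disjoint {P : Set (ℝ × ℝ)} (hg : GenPos P) {p q r : ℝ × ℝ} (hp : p ∈ P)
    (hq : q ∈ P) (hr : r ∈ P) (h1 : p ≠ q) (h2 : p ≠ r) (h3 : q ≠ r) (x : ℝ × ℝ)
    (hx : x ∈ openSegment ℝ p q) (hx' : x ∈ openSegment ℝ p r) : False := by
  apply orient_ne_zero hg hp hq hr h1 h2 h3
  obtain ⟨a, b, ha, hb, hab, rfl⟩ := hx
  obtain ⟨c, d, hc, hd, hcd, he⟩ := hx'
  have e1 := congrArg Prod.fst he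
  have e2 := congrArg Prod.snd he
  simp only [Prod.fst_add, Prod.smul_fst, Prod.snd_add, Prod.smul_snd, smul_eq_mul] at e1 e2
  have ha' : a = 1 - b := by linarith
  have hc' : c = 1 - d := by linarith
  subst ha' hc'
  have f1 : d * (r.1 - p.1) = b * (q.1 - p.1) := by linarith
  have f2 : d * (r.2 - p.2) = b * (q.2 - p.2) := by linarith
  have : d * orient p q r = 0 := by
    unfold orient
    calc d * ((q.1 - p.1) * (r.2 - p.2) - (q.2 - p.2) * (r.1 - p.1))
        = (q.1 - p.1) * (d * (r.2 - p.2)) - (q.2 - p.2) * (d * (r.1 - p.1)) := by ring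
      _ = 0 := by rw [f1, f2]; ring
  exact (mul_eq_zero.mp this).resolve_left hd.ne'

noncomputable def starT (P : Finset (ℝ × ℝ)) (p : ℝ × ℝ) : Finset ((ℝ × ℝ) × (ℝ × ℝ)) :=
  (P.erase p).image (fun q => (p, q))

theorem mem_starT {P : Finset (ℝ × ℝ)} {p : ℝ × ℝ} {e : (ℝ × ℝ) × (ℝ × ℝ)} :
    e ∈ starT P p ↔ e.1 = p ∧ e.2 ∈ P ∧ e.2 ≠ p := by
  unfold starT
  simp only [Finset.mem_image, Finset.mem_erase]
  constructor
  · rintro ⟨q, ⟨h1, h2⟩, rfl⟩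
    exact ⟨rfl, h2, h1⟩
  · rintro ⟨h1, h2, h3⟩
    exact ⟨e.2, ⟨h3, h2⟩, Prod.ext h1.symm rfl⟩

theorem conn_of_root {α : Type*} {R : α → α → Prop} (hs : ∀ x y, R x y → R y x) (s : Set α) (b : α)
    (h : ∀ q ∈ s, Relation.ReflTransGen R q b) :
    ∀ p ∈ s, ∀ q ∈ s, Relation.ReflTransGen R p q := by
  intro p hp q hq
  have : Std.Symm R := ⟨hs⟩
  exact (h p hp).trans (Relation.ReflTransGen.stdSymm.symm _ _ (h q hq))

theorem starT_tree {P : Finset (ℝ × ℝ)} (hg : GenPos (P : Set (ℝ × ℝ))) {p : ℝ × ℝ} (hp : p ∈ P) :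
    IsPlaneSpanningTree P (starT P p) := by
  refine ⟨?_, ?_, ?_, ?_⟩
  · intro e he
    obtain ⟨h1, h2, h3⟩ := mem_starT.mp he
    exact ⟨h1 ▸ hp, h2, fun h => h3 (h ▸ h1)⟩
  · unfold starT
    rw [Finset.card_image_of_injective _ (fun x y h => (Prod.mk.inj h).2), Finset.card_erase_of_mem hp]
  · apply conn_of_root (s := (P : Set (ℝ × ℝ))) (b := p)
    · intro x y h; exact h.symm
    · intro q hq
      by_cases h : q = p
      · rw [h]
      · exact Relation.ReflTransGen.single (Or.inr (mem_starT.mpr ⟨rfl, hq, h⟩))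
  · intro e he f hf hne x hx hx'
    obtain ⟨h1, h2, h3⟩ := mem_starT.mp he
    obtain ⟨g1, g2, g3⟩ := mem_starT.mp hf
    rw [h1] at hx
    rw [g1] at hx'
    exact apex_disjoint hg hp h2 g2 h3.symm g3.symm
      (fun h => hne (Prod.ext (h1.trans g1.symm) h)) x hx hx'

open Classical in
noncomputable def parT (l : ℝ × ℝ × ℝ) (a b q : ℝ × ℝ) : ℝ × ℝ :=
  if q = a then b else if 0 ≤ sideVal l q then b else a

noncomputable def dblT (P : Finset (ℝ × ℝ)) (l : ℝ × ℝ × ℝ) (a b : ℝ × ℝ) :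
    Finset ((ℝ × ℝ) × (ℝ × ℝ)) :=
  (P.erase b).image (fun q => (parT l a b q, q))

theorem mem_dblT {P : Finset (ℝ × ℝ)} {l : ℝ × ℝ × ℝ} {a b : ℝ × ℝ} {e : (ℝ × ℝ) × (ℝ × ℝ)} :
    e ∈ dblT P l a b ↔ e.1 = parT l a b e.2 ∧ e.2 ∈ P ∧ e.2 ≠ b := by
  unfold dblT
  simp only [Finset.mem_image, Finset.mem_erase]
  constructor
  · rintro ⟨q, ⟨h1, h2⟩, rfl⟩
    exact ⟨rfl, h2, h1⟩
  · rintro ⟨h1, h2, h3⟩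
    exact ⟨e.2, ⟨h3, h2⟩, Prod.ext h1.symm rfl⟩

theorem sideVal_comb (l : ℝ × ℝ × ℝ) (p q : ℝ × ℝ) (s t : ℝ) (h : s + t = 1) :
    sideVal l (s • p + t • q) = s * sideVal l p + t * sideVal l q := by
  unfold sideVal
  simp only [Prod.fst_add, Prod.smul_fst, Prod.snd_add, Prod.smul_snd, smul_eq_mul]
  have : s = 1 - t := by linarith
  subst this
  ring

theorem dblT_tree {P : Finset (ℝ × ℝ)} (hg : GenPos (P : Set (ℝ × ℝ))) {l : ℝ × ℝ × ℝ}
    {a b : ℝ × ℝ} (ha : a ∈ P) (hb : b ∈ P) (hfa : sideVal l a < 0) (hfb : 0 ≤ sideVal l b) :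
    IsPlaneSpanningTree P (dblT P l a b) := by
  have hab : a ≠ b := by rintro rfl; linarith
  have hpar : ∀ q, q ≠ b → (parT l a b q = b ∧ (q = a ∨ 0 ≤ sideVal l q)) ∨
      (parT l a b q = a ∧ q ≠ a ∧ sideVal l q < 0) := by
    intro q hq
    unfold parT
    by_cases h1 : q = a
    · simp [h1]
    · by_cases h2 : 0 ≤ sideVal l q
      · simp [h1, h2]
      · simp only [h1, h2, if_false]
        exact Or.inr ⟨trivial, h1, by linarith⟩
  refine ⟨?_, ?_, ?_, ?_⟩
  · intro e he
    obtain ⟨h1, h2, h3⟩ := mem_dblT.mp he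
    rcases hpar e.2 h3 with ⟨h, _⟩ | ⟨h, h', _⟩
    · rw [h1, h]; exact ⟨hb, h2, h3.symm⟩
    · rw [h1, h]; exact ⟨ha, h2, h'.symm⟩
  · unfold dblT
    rw [Finset.card_image_of_injective _ (fun x y h => (Prod.mk.inj h).2), Finset.card_erase_of_mem hb]
  · apply conn_of_root (s := (P : Set (ℝ × ℝ))) (b := b)
    · intro x y h; exact h.symm
    · have hA : Relation.ReflTransGen (fun x y => (x, y) ∈ dblT P l a b ∨ (y, x) ∈ dblT P l a b) a b :=
        Relation.ReflTransGen.single (Or.inr (mem_dblT.mpr ⟨by simp [parT], ha, hab⟩))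
      intro q hq
      by_cases h : q = b
      · rw [h]
      · rcases hpar q h with ⟨h1, _⟩ | ⟨h1, _⟩
        · exact Relation.ReflTransGen.single (Or.inr (mem_dblT.mpr ⟨h1.symm, hq, h⟩))
        · exact Relation.ReflTransGen.head (Or.inr (mem_dblT.mpr ⟨h1.symm, hq, h⟩)) hA
  · classical
    have key : ∀ q ∈ P, q ≠ b → ∀ r ∈ P, r ≠ b → q ≠ r → parT l a b q = b → parT l a b r = a →
        ∀ x, x ∈ openSegment ℝ b q → x ∈ openSegment ℝ a r → False := by
      intro q hq hqb r hr hrb hqr h1 h2 x hx hx'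
      rcases hpar r hrb with ⟨h, _⟩ | ⟨_, hra, hrs⟩
      · exact hab (h2.symm.trans h)
      rcases hpar q hqb with ⟨_, h⟩ | ⟨h, _⟩
      · rcases h with rfl | h
        · rw [openSegment_symm] at hx
          exact apex_disjoint hg hq hb hr hab hra.symm hrb.symm x hx hx'
        · obtain ⟨s, t, hs, ht, hst, rfl⟩ := hx
          obtain ⟨s', t', hs', ht', hst', he⟩ := hx'
          have e1 := sideVal_comb l b q s t hst
          have e2 := sideVal_comb l a r s' t' hst'
          rw [he, e1] at e2
          have := mul_nonneg hs.le hfb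
          have := mul_nonneg ht.le h
          have := mul_neg_of_pos_of_neg hs' hfa
          have := mul_neg_of_pos_of_neg ht' hrs
          linarith
      · exact hab (h.symm.trans h1)
    intro e he f hf hne x hx hx'
    obtain ⟨h1, h2, h3⟩ := mem_dblT.mp he
    obtain ⟨g1, g2, g3⟩ := mem_dblT.mp hf
    have hne2 : e.2 ≠ f.2 := by
      intro h
      exact hne (Prod.ext (by rw [h1, g1, h]) h)
    rw [h1] at hx
    rw [g1] at hx'
    rcases hpar e.2 h3 with ⟨i1, i2⟩ | ⟨i1, i2, i3⟩ <;> rcases hpar f.2 g3 with ⟨j1, j2⟩ | ⟨j1, j2, j3⟩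
    · rw [i1] at hx; rw [j1] at hx'
      exact apex_disjoint hg hb h2 g2 h3.symm g3.symm hne2 x hx hx'
    · rw [i1] at hx; rw [j1] at hx'
      exact key _ h2 h3 _ g2 g3 hne2 i1 j1 x hx hx'
    · rw [i1] at hx; rw [j1] at hx'
      exact key _ g2 g3 _ h2 h3 hne2.symm j1 i1 x hx' hx
    · rw [i1] at hx; rw [j1] at hx'
      exact apex_disjoint hg ha h2 g2 i2.symm j2.symm hne2 x hx hx'

/-- The pairwise condition on two spokes. -/
def PairOK {ι : Type*} (f : ι → ℝ × ℝ × ℝ) (a b : ι → ℝ × ℝ) (i j : ι) : Prop :=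
  sideVal (f i) (a j) < 0 ∧ 0 ≤ sideVal (f i) (b j) ∧ 0 ≤ sideVal (f j) (a i) ∧ sideVal (f j) (b i) < 0

theorem cover_of_spokes {ι : Type*} [Fintype ι] {P : Finset (ℝ × ℝ)}
    (hg : GenPos (P : Set (ℝ × ℝ))) (f : ι → ℝ × ℝ × ℝ) (a b : ι → ℝ × ℝ)
    (ha : ∀ i, a i ∈ P) (hb : ∀ i, b i ∈ P)
    (hfa : ∀ i, sideVal (f i) (a i) < 0) (hfb : ∀ i, 0 ≤ sideVal (f i) (b i))
    (hp : ∀ i j, i ≠ j → PairOK f a b i j ∨ PairOK f a b j i) :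
    2 * Fintype.card ι ≤ P.card ∧ ∃ T : Finset (Finset ((ℝ × ℝ) × (ℝ × ℝ))),
      T.card ≤ P.card - Fintype.card ι ∧ CoversCompleteGraph P T := by
  classical
  have haa : Function.Injective a := by
    intro i j h
    by_contra hij
    rcases hp i j hij with ⟨h1, h2, h3, h4⟩ | ⟨h1, h2, h3, h4⟩
    · rw [h] at h3; linarith [hfa j]
    · rw [← h] at h3; linarith [hfa i]
  have hbb : Function.Injective b := by
    intro i j h
    by_contra hij
    rcases hp i j hij with ⟨h1, h2, h3, h4⟩ | ⟨h1, h2, h3, h4⟩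
    · rw [h] at h4; linarith [hfb j]
    · rw [← h] at h4; linarith [hfb i]
  have hab : ∀ i j, a i ≠ b j := by
    intro i j h
    by_cases hij : i = j
    · subst hij
      have := hfa i; rw [h] at this; linarith [hfb i]
    rcases hp i j hij with ⟨h1, h2, h3, h4⟩ | ⟨h1, h2, h3, h4⟩
    · rw [← h] at h2; linarith [hfa i]
    · rw [h] at h1; linarith [hfb j]
  set Ua := Finset.univ.image a
  set Ub := Finset.univ.image b
  have hcard : (Ua ∪ Ub).card = 2 * Fintype.card ι := by
    rw [Finset.card_union_of_disjoint, Finset.card_image_of_injective _ haa,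
      Finset.card_image_of_injective _ hbb, Finset.card_univ]
    · ring
    · rw [Finset.disjoint_left]
      intro x hx hx'
      simp only [Ua, Ub, Finset.mem_image, Finset.mem_univ, true_and] at hx hx'
      obtain ⟨i, rfl⟩ := hx
      obtain ⟨j, h⟩ := hx'
      exact hab i j h.symm
  have hsub : Ua ∪ Ub ⊆ P := by
    intro x hx
    simp only [Ua, Ub, Finset.mem_union, Finset.mem_image, Finset.mem_univ, true_and] at hx
    rcases hx with ⟨i, rfl⟩ | ⟨i, rfl⟩
    · exact ha i
    · exact hb i
  have hle : 2 * Fintype.card ι ≤ P.card := hcard ▸ Finset.card_le_card hsub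
  refine ⟨hle, Finset.univ.image (fun i => dblT P (f i) (a i) (b i)) ∪
    (P \ (Ua ∪ Ub)).image (starT P), ?_, ?_, ?_⟩
  · refine (Finset.card_union_le _ _).trans ?_
    have h1 : (Finset.univ.image (fun i => dblT P (f i) (a i) (b i))).card ≤ Fintype.card ι :=
      Finset.card_image_le
    have h2 : ((P \ (Ua ∪ Ub)).image (starT P)).card ≤ P.card - 2 * Fintype.card ι := by
      refine Finset.card_image_le.trans ?_
      rw [Finset.card_sdiff_of_subset hsub, hcard]
    omega
  · intro E hE
    rw [Finset.mem_union] at hE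
    rcases hE with hE | hE
    · obtain ⟨i, _, rfl⟩ := Finset.mem_image.mp hE
      exact dblT_tree hg (ha i) (hb i) (hfa i) (hfb i)
    · obtain ⟨p, hp', rfl⟩ := Finset.mem_image.mp hE
      exact starT_tree hg (Finset.mem_sdiff.mp hp').1
  · classical
    have edge : ∀ i, ∀ q ∈ P, q ≠ b i → ∀ p, parT (f i) (a i) (b i) q = p →
        ∃ E ∈ Finset.univ.image (fun i => dblT P (f i) (a i) (b i)) ∪
    (P \ (Ua ∪ Ub)).image (starT P), (p, q) ∈ E ∨ (q, p) ∈ E := by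
      intro i q hq hqb p hpar
      refine ⟨dblT P (f i) (a i) (b i), Finset.mem_union_left _ (Finset.mem_image_of_mem _ (Finset.mem_univ i)), Or.inl ?_⟩
      exact mem_dblT.mpr ⟨hpar.symm, hq, hqb⟩
    have parA : ∀ i q, q ≠ a i → sideVal (f i) q < 0 → parT (f i) (a i) (b i) q = a i := by
      intro i q h1 h2
      simp [parT, h1, not_le.mpr h2]
    have parB : ∀ i q, 0 ≤ sideVal (f i) q → parT (f i) (a i) (b i) q = b i := by
      intro i q h2
      simp [parT, h2]
    have sw : ∀ p q, (∃ E ∈ Finset.univ.image (fun i => dblT P (f i) (a i) (b i)) ∪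
        (P \ (Ua ∪ Ub)).image (starT P), (p, q) ∈ E ∨ (q, p) ∈ E) →
        (∃ E ∈ Finset.univ.image (fun i => dblT P (f i) (a i) (b i)) ∪
        (P \ (Ua ∪ Ub)).image (starT P), (q, p) ∈ E ∨ (p, q) ∈ E) := by
      rintro p q ⟨E, h1, h2⟩
      exact ⟨E, h1, h2.symm⟩
    have pairs : ∀ i j, PairOK f a b i j →
        (∃ E ∈ Finset.univ.image (fun i => dblT P (f i) (a i) (b i)) ∪
        (P \ (Ua ∪ Ub)).image (starT P), (a i, a j) ∈ E ∨ (a j, a i) ∈ E) ∧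
        (∃ E ∈ Finset.univ.image (fun i => dblT P (f i) (a i) (b i)) ∪
        (P \ (Ua ∪ Ub)).image (starT P), (b i, b j) ∈ E ∨ (b j, b i) ∈ E) ∧
        (∃ E ∈ Finset.univ.image (fun i => dblT P (f i) (a i) (b i)) ∪
        (P \ (Ua ∪ Ub)).image (starT P), (b j, a i) ∈ E ∨ (a i, b j) ∈ E) ∧
        (∃ E ∈ Finset.univ.image (fun i => dblT P (f i) (a i) (b i)) ∪
        (P \ (Ua ∪ Ub)).image (starT P), (a j, b i) ∈ E ∨ (b i, a j) ∈ E) := by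
      rintro i j ⟨h1, h2, h3, h4⟩
      have hij : i ≠ j := by
        rintro rfl
        linarith
      exact ⟨edge i _ (ha j) (hab j i) _ (parA i _ (haa.ne hij.symm) h1),
        edge i _ (hb j) (hbb.ne hij.symm) _ (parB i _ h2),
        edge j _ (ha i) (hab i j) _ (parB j _ h3),
        edge j _ (hb i) (hbb.ne hij) _ (parA j _ (hab j i).symm h4)⟩
    intro p hpP q hqP hpq
    by_cases hpu : p ∈ Ua ∪ Ub
    swap
    · exact ⟨starT P p, Finset.mem_union_right _ (Finset.mem_image_of_mem _ (Finset.mem_sdiff.mpr ⟨hpP, hpu⟩)),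
        Or.inl (mem_starT.mpr ⟨rfl, hqP, hpq.symm⟩)⟩
    by_cases hqu : q ∈ Ua ∪ Ub
    swap
    · exact ⟨starT P q, Finset.mem_union_right _ (Finset.mem_image_of_mem _ (Finset.mem_sdiff.mpr ⟨hqP, hqu⟩)),
        Or.inr (mem_starT.mpr ⟨rfl, hpP, hpq⟩)⟩
    simp only [Ua, Ub, Finset.mem_union, Finset.mem_image, Finset.mem_univ, true_and] at hpu hqu
    rcases hpu with ⟨i, rfl⟩ | ⟨i, rfl⟩ <;> rcases hqu with ⟨j, rfl⟩ | ⟨j, rfl⟩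
    · have hij : i ≠ j := fun h => hpq (by rw [h])
      rcases hp i j hij with h | h
      · exact (pairs i j h).1
      · exact sw _ _ (pairs j i h).1
    · by_cases hij : i = j
      · subst hij
        exact sw _ _ (edge i _ (ha i) (hab i i) _ (by simp [parT]))
      rcases hp i j hij with h | h
      · exact sw _ _ (pairs i j h).2.2.1
      · exact (pairs j i h).2.2.2
    · by_cases hij : i = j
      · subst hij
        exact (edge i _ (ha i) (hab i i) _ (by simp [parT]))
      rcases hp i j hij with h | h
      · exact sw _ _ (pairs i j h).2.2.2
      · exact (pairs j i h).2.2.1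
    · have hij : i ≠ j := fun h => hpq (by rw [h])
      rcases hp i j hij with h | h
      · exact (pairs i j h).2.1
      · exact sw _ _ (pairs j i h).2.1

theorem starT_inj {P : Finset (ℝ × ℝ)} {p q : ℝ × ℝ} (hp : p ∈ P) (hq : q ∈ P)
    (h : starT P p = starT P q) : p = q := by
  by_contra hne
  have : (p, q) ∈ starT P p := mem_starT.mpr ⟨rfl, hq, fun h => hne h.symm⟩
  rw [h] at this
  exact hne (mem_starT.mp this).1

theorem pad_cover {P : Finset (ℝ × ℝ)} (hg : GenPos (P : Set (ℝ × ℝ)))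
    {T : Finset (Finset ((ℝ × ℝ) × (ℝ × ℝ)))} (hT : CoversCompleteGraph P T) (c : ℕ)
    (h1 : T.card ≤ c) (h2 : c ≤ P.card) :
    ∃ T' : Finset (Finset ((ℝ × ℝ) × (ℝ × ℝ))), T'.card = c ∧ CoversCompleteGraph P T' := by
  classical
  have hcard : (P.image (starT P)).card = P.card :=
    Finset.card_image_of_injOn (fun p hp q hq h => starT_inj hp hq h)
  obtain ⟨T', hs, hs', hc⟩ := Finset.exists_subsuperset_card_eq
    (s := T) (t := T ∪ P.image (starT P)) (n := c) Finset.subset_union_left h1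
    (h2.trans (hcard ▸ Finset.card_le_card Finset.subset_union_right))
  refine ⟨T', hc, ?_, ?_⟩
  · intro E hE
    rcases Finset.mem_union.mp (hs' hE) with h | h
    · exact hT.1 E h
    · obtain ⟨p, hp, rfl⟩ := Finset.mem_image.mp h
      exact starT_tree hg hp
  · intro p hp q hq hpq
    obtain ⟨E, hE, h⟩ := hT.2 p hp q hq hpq
    exact ⟨E, hs hE, h⟩

theorem sideVal_cont (l : ℝ × ℝ × ℝ) : Continuous (sideVal l) := by
  unfold sideVal
  fun_prop

/-- Far points in a generic direction give points of P with prescribed signs. -/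
theorem spoke_dir {P : Finset (ℝ × ℝ)} {S : Finset (ℝ × ℝ × ℝ)} (hS : SpokeSet P S) (u : ℝ × ℝ)
    (hu : ∀ l ∈ S, l.1 * u.1 + l.2.1 * u.2 ≠ 0) (hu0 : u ≠ 0) :
    ∃ p ∈ P, ∀ l ∈ S, 0 < sideVal l p * (l.1 * u.1 + l.2.1 * u.2) := by
  classical
  obtain ⟨R, hR0, hR⟩ : ∃ R : ℝ, 0 < R ∧ ∀ l ∈ S, ∀ r ≥ R,
      0 < sideVal l (r • u) * (l.1 * u.1 + l.2.1 * u.2) := by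
    refine ⟨1 + ∑ l ∈ S, |l.2.2| / |l.1 * u.1 + l.2.1 * u.2|, ?_, ?_⟩
    · have : 0 ≤ ∑ l ∈ S, |l.2.2| / |l.1 * u.1 + l.2.1 * u.2| :=
        Finset.sum_nonneg (fun i _ => by positivity)
      linarith
    · intro l hl r hr
      have h1 : |l.2.2| / |l.1 * u.1 + l.2.1 * u.2| ≤ ∑ l ∈ S, |l.2.2| / |l.1 * u.1 + l.2.1 * u.2| :=
        Finset.single_le_sum (f := fun l : ℝ × ℝ × ℝ => |l.2.2| / |l.1 * u.1 + l.2.1 * u.2|)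
          (fun i _ => by positivity) hl
      have hd := hu l hl
      have e : sideVal l (r • u) = r * (l.1 * u.1 + l.2.1 * u.2) - l.2.2 := by
        unfold sideVal
        simp only [Prod.smul_fst, Prod.smul_snd, smul_eq_mul]
        ring
      rw [e]
      set d := l.1 * u.1 + l.2.1 * u.2
      have hd' : 0 < |d| := abs_pos.mpr hd
      have h2 : |l.2.2| / |d| < r := by linarith
      rw [div_lt_iff₀ hd'] at h2
      have h3 : l.2.2 * d ≤ |l.2.2| * |d| := by
        rw [← abs_mul]; exact le_abs_self _
      have h4 : |d| * |d| = d * d := abs_mul_abs_self d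
      have h5 : |l.2.2| * |d| < r * (d * d) := by
        rw [← h4, ← mul_assoc]
        exact mul_lt_mul_of_pos_right h2 hd'
      linarith [show (r * d - l.2.2) * d = r * (d * d) - l.2.2 * d by ring]
  have hmem : ∀ r ≥ R, r • u ∈ (linesUnion S)ᶜ := by
    intro r hr hmem
    unfold linesUnion at hmem
    simp only [Set.mem_iUnion] at hmem
    obtain ⟨l, hl, h⟩ := hmem
    have := hR l hl r hr
    have h0 : sideVal l (r • u) = 0 := by
      unfold sideVal
      unfold lineOf at h
      have h' : l.1 * (r • u).1 + l.2.1 * (r • u).2 = l.2.2 := h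
      linarith
    rw [h0] at this
    linarith
  have hpre : IsPreconnected ((fun r : ℝ => r • u) '' Set.Ici R) := by
    apply IsPreconnected.image isPreconnected_Ici
    fun_prop
  have hsub : ((fun r : ℝ => r • u) '' Set.Ici R) ⊆ connectedComponentIn (linesUnion S)ᶜ (R • u) := by
    apply hpre.subset_connectedComponentIn
    · exact ⟨R, Set.self_mem_Ici, rfl⟩
    · rintro _ ⟨r, hr, rfl⟩
      exact hmem r hr
  have hunb : ¬ Bornology.IsBounded (connectedComponentIn (linesUnion S)ᶜ (R • u)) := by
    intro hb
    obtain ⟨C, hC⟩ := (hb.subset hsub).exists_norm_le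
    have hn : 0 < ‖u‖ := norm_pos_iff.mpr hu0
    have := hC ((max R ((C + 1) / ‖u‖)) • u) ⟨_, Set.mem_Ici.mpr (le_max_left _ _), rfl⟩
    rw [norm_smul, Real.norm_eq_abs] at this
    have h2 : (C + 1) / ‖u‖ ≤ |max R ((C + 1) / ‖u‖)| := (le_max_right _ _).trans (le_abs_self _)
    rw [div_le_iff₀ hn] at h2
    linarith
  obtain ⟨p, hpP, hp⟩ := hS.2.2 _ ⟨⟨R • u, hmem R le_rfl, rfl⟩, hunb⟩
  refine ⟨p, hpP, ?_⟩
  intro l hl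
  by_contra hneg
  have hcc : IsPreconnected (connectedComponentIn (linesUnion S)ᶜ (R • u)) :=
    isPreconnected_connectedComponentIn
  have hcont : ContinuousOn (fun x => sideVal l x * (l.1 * u.1 + l.2.1 * u.2))
      (connectedComponentIn (linesUnion S)ᶜ (R • u)) :=
    ((sideVal_cont l).mul continuous_const).continuousOn
  have hRm : R • u ∈ connectedComponentIn (linesUnion S)ᶜ (R • u) :=
    mem_connectedComponentIn (hmem R le_rfl)
  have := hcc.intermediate_value hp hRm hcont
  obtain ⟨x, hx, hx0⟩ := this ⟨not_lt.mp hneg, (hR l hl R le_rfl).le⟩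
  have hx1 := connectedComponentIn_subset _ _ hx
  apply hx1
  unfold linesUnion
  simp only [Set.mem_iUnion]
  refine ⟨l, hl, ?_⟩
  have h0 : sideVal l x = 0 := (mul_eq_zero.mp hx0).resolve_right (hu l hl)
  unfold sideVal at h0
  show l.1 * x.1 + l.2.1 * x.2 = l.2.2
  linarith

theorem exists_eps {α : Type*} (S : Finset α) (c d : α → ℝ) (hc : ∀ m ∈ S, c m ≠ 0) :
    ∃ ε : ℝ, 0 < ε ∧ ∀ m ∈ S, 0 < c m * (c m + ε * d m) := by
  classical
  induction S using Finset.induction_on with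
  | empty => exact ⟨1, one_pos, by simp⟩
  | insert a S _ ih =>
    obtain ⟨ε, h0, h⟩ := ih (fun m hm => hc m (Finset.mem_insert_of_mem hm))
    have ha := hc a (Finset.mem_insert_self _ _)
    have hc2 : 0 < c a * c a := mul_self_pos.mpr ha
    have hD : 0 < |c a * d a| + 1 := by positivity
    refine ⟨min ε (c a * c a / (|c a * d a| + 1)), lt_min h0 (by positivity), ?_⟩
    set η := min ε (c a * c a / (|c a * d a| + 1)) with hη
    have hη0 : 0 < η := lt_min h0 (by positivity)
    intro m hm
    rcases Finset.mem_insert.mp hm with rfl | hm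
    · have h1 : η ≤ c m * c m / (|c m * d m| + 1) := min_le_right _ _
      rw [le_div_iff₀ hD] at h1
      have h2 := neg_abs_le (c m * d m)
      nlinarith
    · have h1 : η ≤ ε := min_le_left _ _
      have h2 := h m hm
      have h3 : 0 < c m * c m := mul_self_pos.mpr (hc m (Finset.mem_insert_of_mem hm))
      by_cases h4 : 0 ≤ c m * d m
      · nlinarith [mul_nonneg hη0.le h4]
      · nlinarith

theorem part_one {P : Finset (ℝ × ℝ)} (hg : GenPos (P : Set (ℝ × ℝ))) {S : Finset (ℝ × ℝ × ℝ)}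
    (hS : SpokeSet P S) :
    ∃ T : Finset (Finset ((ℝ × ℝ) × (ℝ × ℝ))), T.card = P.card - S.card ∧ CoversCompleteGraph P T := by
  classical
  have hdir : ∀ l : {l // l ∈ S}, ∃ u : ℝ × ℝ, u ≠ 0 ∧ 0 < l.1.1 * u.1 + l.1.2.1 * u.2 ∧
      ∀ m ∈ S, m ≠ l.1 → 0 < (m.1 * l.1.2.1 - m.2.1 * l.1.1) * (m.1 * u.1 + m.2.1 * u.2) := by
    rintro ⟨l, hl⟩
    obtain ⟨ε, h0, hε⟩ := exists_eps (S.erase l) (fun m => m.1 * l.2.1 - m.2.1 * l.1)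
      (fun m => m.1 * l.1 + m.2.1 * l.2.1) (by
        intro m hm
        exact hS.2.1 m (Finset.mem_of_mem_erase hm) l hl (Finset.ne_of_mem_erase hm))
    have hpos : 0 < l.1 * l.1 + l.2.1 * l.2.1 := by
      have := hS.1 l hl
      by_contra hc
      apply this
      have e1 : l.1 = 0 := by nlinarith [mul_self_nonneg l.1, mul_self_nonneg l.2.1]
      have e2 : l.2.1 = 0 := by nlinarith [mul_self_nonneg l.1, mul_self_nonneg l.2.1]
      rw [e1, e2]
    have hp2 : 0 < l.1 * (l.2.1 + ε * l.1) + l.2.1 * (-l.1 + ε * l.2.1) := by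
      nlinarith [mul_pos h0 hpos]
    refine ⟨(l.2.1 + ε * l.1, -l.1 + ε * l.2.1), ?_, hp2, ?_⟩
    · intro h
      rw [Prod.ext_iff] at h
      obtain ⟨h1, h2⟩ := h
      simp only [Prod.fst_zero, Prod.snd_zero] at h1 h2
      rw [h1, h2] at hp2
      simp at hp2
    · intro m hm hne
      have := hε m (Finset.mem_erase.mpr ⟨hne, hm⟩)
      simp only at this ⊢
      have e : m.1 * (l.2.1 + ε * l.1) + m.2.1 * (-l.1 + ε * l.2.1) =
        (m.1 * l.2.1 - m.2.1 * l.1) + ε * (m.1 * l.1 + m.2.1 * l.2.1) := by ring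
      rw [e]; exact this
  choose u hu0 hul hum using hdir
  have hne : ∀ i : {l // l ∈ S}, ∀ m ∈ S, m.1 * (u i).1 + m.2.1 * (u i).2 ≠ 0 := by
    intro i m hm h
    by_cases hmi : m = i.1
    · subst hmi
      linarith [hul i]
    · have := hum i m hm hmi
      rw [h] at this; simp at this
  have hB := fun i => spoke_dir hS (u i) (hne i) (hu0 i)
  have hA := fun i => spoke_dir hS (-(u i)) (by
    intro m hm h
    apply hne i m hm
    simp only [Prod.fst_neg, Prod.snd_neg] at h
    linarith) (neg_ne_zero.mpr (hu0 i))
  choose b hbP hb using hB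
  choose a haP ha using hA
  have ha' : ∀ i, ∀ m ∈ S, sideVal m (a i) * (m.1 * (u i).1 + m.2.1 * (u i).2) < 0 := by
    intro i m hm
    have := ha i m hm
    simp only [Prod.fst_neg, Prod.snd_neg] at this
    nlinarith
  have key : ∀ i j : {l // l ∈ S}, i ≠ j → 0 < j.1.1 * i.1.2.1 - j.1.2.1 * i.1.1 →
      PairOK (fun i : {l // l ∈ S} => i.1) a b j i := by
    intro i j hij hpos
    have hv : j.1 ≠ i.1 := fun h => hij (Subtype.ext h.symm)
    have h1 := hum i j.1 j.2 hv
    have h2 := hum j i.1 i.2 hv.symm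
    have h3 : 0 < j.1.1 * (u i).1 + j.1.2.1 * (u i).2 := (mul_pos_iff_of_pos_left hpos).mp h1
    have h4 : i.1.1 * (u j).1 + i.1.2.1 * (u j).2 < 0 := by
      by_contra hc
      have : (i.1.1 * j.1.2.1 - i.1.2.1 * j.1.1) < 0 := by linarith
      nlinarith
    have a1 := ha' i j.1 j.2
    have a2 := ha' j i.1 i.2
    have b1 := hb i j.1 j.2
    have b2 := hb j i.1 i.2
    refine ⟨?_, ?_, ?_, ?_⟩
    · show sideVal j.1 (a i) < 0
      by_contra hc
      push Not at hc
      nlinarith [mul_nonneg hc h3.le]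
    · show 0 ≤ sideVal j.1 (b i)
      exact ((pos_iff_pos_of_mul_pos b1).mpr h3).le
    · show 0 ≤ sideVal i.1 (a j)
      by_contra hc
      push Not at hc
      nlinarith [mul_pos_of_neg_of_neg hc h4]
    · show sideVal i.1 (b j) < 0
      by_contra hc
      push Not at hc
      nlinarith [mul_nonpos_of_nonneg_of_nonpos hc h4.le]
  obtain ⟨h2, T, hT, hcov⟩ := cover_of_spokes hg (fun i : {l // l ∈ S} => i.1) a b haP hbP
    (by
      intro i
      have := ha' i i.1 i.2
      by_contra hc
      push Not at hc
      nlinarith [mul_nonneg hc (hul i).le])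
    (by
      intro i
      have := hb i i.1 i.2
      exact ((pos_iff_pos_of_mul_pos this).mpr (hul i)).le)
    (by
      intro i j hij
      have hv : j.1 ≠ i.1 := fun h => hij (Subtype.ext h.symm)
      have := hS.2.1 j.1 j.2 i.1 i.2 hv
      rcases lt_or_gt_of_ne this with h | h
      · left
        exact key j i hij.symm (by linarith)
      · right
        exact key i j hij h)
  have hcS : Fintype.card {l // l ∈ S} = S.card := Fintype.card_coe S
  rw [hcS] at hT
  exact pad_cover hg hcov _ hT (Nat.sub_le _ _)

/-- There is an `r`-chain of length `k` inside `U`. -/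
def HasChain {α : Type*} (r : α → α → Prop) (U : Finset α) (k : ℕ) : Prop :=
  ∃ c : ℕ → α, (∀ i < k, c i ∈ U) ∧ ∀ i j, i < j → j < k → r (c i) (c j)

theorem HasChain.prepend {α : Type*} {r : α → α → Prop} {U : Finset α} {k : ℕ} (x : α) (hx : x ∈ U)
    (c : ℕ → α) (hc : ∀ i < k, c i ∈ U) (hr : ∀ i j, i < j → j < k → r (c i) (c j))
    (hxr : ∀ i < k, r x (c i)) : HasChain r U (k + 1) := by
  refine ⟨fun i => Nat.casesOn i x c, ?_, ?_⟩
  · intro i hi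
    cases i with
    | zero => exact hx
    | succ i => exact hc i (by omega)
  · intro i j hij hj
    cases j with
    | zero => omega
    | succ j =>
      cases i with
      | zero => exact hxr j (by omega)
      | succ i => exact hr i j (by omega) (by omega)

theorem chain_of_total {α : Type*} [Nonempty α] [DecidableEq α] (s : α → α → Prop) (m : ℕ) : ∀ (U : Finset α),
    (∀ x ∈ U, ¬ s x x) → (∀ x ∈ U, ∀ y ∈ U, ∀ z ∈ U, s x y → s y z → s x z) →
    (∀ x ∈ U, ∀ y ∈ U, x ≠ y → s x y ∨ s y x) → m ≤ U.card → HasChain s U m := by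
  classical
  induction m with
  | zero =>
    intro U _ _ _ _
    exact ⟨fun _ => Classical.arbitrary α, by simp, by simp⟩
  | succ m ih =>
    intro U hirr htr htot hcard
    have hne : U.Nonempty := by
      rw [← Finset.card_pos]; omega
    obtain ⟨x, hx, hmax⟩ := Finset.exists_max_image U (fun x => (U.filter (fun y => s x y)).card) hne
    have hmin : ∀ z ∈ U, ¬ s z x := by
      intro z hz hzx
      have : (U.filter (fun y => s x y)) ⊂ (U.filter (fun y => s z y)) := by
        rw [Finset.ssubset_iff_of_subset]
        · exact ⟨x, by simp [hx, hzx], by simp [hx, hirr x hx]⟩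
        · intro y hy
          rw [Finset.mem_filter] at hy ⊢
          exact ⟨hy.1, htr z hz x hx y hy.1 hzx hy.2⟩
      have := Finset.card_lt_card this
      have := hmax z hz
      omega
    have hsub : ∀ y ∈ U.erase x, y ∈ U := fun y hy => Finset.mem_of_mem_erase hy
    obtain ⟨c, hc, hr⟩ := ih (U.erase x) (fun y hy => hirr y (hsub y hy))
      (fun a ha b hb d hd => htr a (hsub a ha) b (hsub b hb) d (hsub d hd))
      (fun a ha b hb => htot a (hsub a ha) b (hsub b hb))
      (by rw [Finset.card_erase_of_mem hx]; omega)
    refine HasChain.prepend x hx c (fun i hi => hsub _ (hc i hi)) hr ?_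
    intro i hi
    have h1 := hc i hi
    rcases htot x hx (c i) (hsub _ h1) (Finset.ne_of_mem_erase h1).symm with h | h
    · exact h
    · exact absurd h (hmin _ (hsub _ h1))

/-- Erdos-Szekeres for two partial orders. -/
theorem two_orders {α : Type*} [Nonempty α] [DecidableEq α] (r s : α → α → Prop) (q : ℕ) (p : ℕ) : ∀ (U : Finset α),
    (∀ x ∈ U, ∀ y ∈ U, ∀ z ∈ U, r x y → r y z → r x z) →
    (∀ x ∈ U, ¬ s x x) → (∀ x ∈ U, ∀ y ∈ U, ∀ z ∈ U, s x y → s y z → s x z) →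
    (∀ x ∈ U, ∀ y ∈ U, x ≠ y → (r x y ∨ r y x) ∨ (s x y ∨ s y x)) →
    p * q < U.card → HasChain r U (p + 1) ∨ HasChain s U (q + 1) := by
  classical
  induction p with
  | zero =>
    intro U _ _ _ _ hcard
    left
    have hne : U.Nonempty := by
      rw [← Finset.card_pos]; omega
    exact ⟨fun _ => hne.choose, fun _ _ => hne.choose_spec, by intro i j h1 h2; omega⟩
  | succ p ih =>
    intro U hrt hsi hst htot hcard
    set M := U.filter (fun x => ∀ y ∈ U, ¬ r y x) with hM
    have hMU : M ⊆ U := Finset.filter_subset _ _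
    by_cases hMc : q + 1 ≤ M.card
    · right
      obtain ⟨c, h1, h2⟩ := chain_of_total s (q + 1) M (fun x hx => hsi x (hMU hx))
        (fun a ha b hb d hd => hst a (hMU ha) b (hMU hb) d (hMU hd))
        (by
          intro x hx y hy hxy
          rcases htot x (hMU hx) y (hMU hy) hxy with (h | h) | h
          · exact absurd h ((Finset.mem_filter.mp hy).2 x (hMU hx))
          · exact absurd h ((Finset.mem_filter.mp hx).2 y (hMU hy))
          · exact h) hMc
      exact ⟨c, fun i hi => hMU (h1 i hi), h2⟩
    · have hsub : ∀ y ∈ U \ M, y ∈ U := fun y hy => (Finset.mem_sdiff.mp hy).1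
      have hc : p * q < (U \ M).card := by
        rw [Finset.card_sdiff_of_subset hMU]
        have : (p + 1) * q = p * q + q := by ring
        omega
      rcases ih (U \ M) (fun a ha b hb d hd => hrt a (hsub a ha) b (hsub b hb) d (hsub d hd))
        (fun x hx => hsi x (hsub x hx))
        (fun a ha b hb d hd => hst a (hsub a ha) b (hsub b hb) d (hsub d hd))
        (fun a ha b hb => htot a (hsub a ha) b (hsub b hb)) hc with ⟨c, h1, h2⟩ | ⟨c, h1, h2⟩
      · left
        have h0 := h1 0 (by omega)
        obtain ⟨y, hy, hry⟩ : ∃ y ∈ U, r y (c 0) := by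
          by_contra hcon
          push Not at hcon
          exact (Finset.mem_sdiff.mp h0).2 (Finset.mem_filter.mpr ⟨hsub _ h0, hcon⟩)
        refine HasChain.prepend y hy c (fun i hi => hsub _ (h1 i hi)) h2 ?_
        intro i hi
        rcases Nat.eq_zero_or_pos i with rfl | hi0
        · exact hry
        · exact hrt y hy _ (hsub _ h0) _ (hsub _ (h1 i hi)) hry (h2 0 i hi0 hi)
      · right
        exact ⟨c, fun i hi => hsub _ (h1 i hi), h2⟩

theorem orient_cyc (p q r : ℝ × ℝ) : orient p q r = orient r p q := by
  unfold orient; ring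

theorem orient_swap (p q r : ℝ × ℝ) : orient p q r = - orient p r q := by
  unfold orient; ring

theorem orient_tri (v p q r : ℝ × ℝ) : (q.1 - v.1) * orient v p r =
    (p.1 - v.1) * orient v q r + (r.1 - v.1) * orient v p q := by
  unfold orient; ring

/-- `U` and `V` are separated by a vertical line. -/
def XSep (U V : Finset (ℝ × ℝ)) : Prop :=
  (∀ u ∈ U, ∀ v ∈ V, u.1 < v.1) ∨ (∀ u ∈ U, ∀ v ∈ V, v.1 < u.1)

theorem XSep.symm {U V : Finset (ℝ × ℝ)} (h : XSep U V) : XSep V U := by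
  rcases h with h | h
  · exact Or.inr (fun v hv u hu => h u hu v hv)
  · exact Or.inl (fun v hv u hu => h u hu v hv)

/-- The order seen from all points of `V`. -/
def seen (V : Finset (ℝ × ℝ)) (p q : ℝ × ℝ) : Prop := ∀ v ∈ V, 0 < orient v p q

theorem seen_trans {U V : Finset (ℝ × ℝ)} (h : XSep U V) : ∀ x ∈ U, ∀ y ∈ U, ∀ z ∈ U,
    seen V x y → seen V y z → seen V x z := by
  intro x hx y hy z hz h1 h2 v hv
  have e := orient_tri v x y z
  have o1 := h1 v hv
  have o2 := h2 v hv
  rcases h with h | h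
  · have a1 := sub_neg.mpr (h x hx v hv)
    have a2 := sub_neg.mpr (h y hy v hv)
    have a3 := sub_neg.mpr (h z hz v hv)
    by_contra hc
    push Not at hc
    have := mul_nonneg_of_nonpos_of_nonpos a2.le hc
    have := mul_neg_of_neg_of_pos a1 o2
    have := mul_neg_of_neg_of_pos a3 o1
    linarith
  · have a1 := sub_pos.mpr (h x hx v hv)
    have a2 := sub_pos.mpr (h y hy v hv)
    have a3 := sub_pos.mpr (h z hz v hv)
    by_contra hc
    push Not at hc
    have := mul_nonpos_of_nonneg_of_nonpos a2.le hc
    have := mul_pos a1 o2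
    have := mul_pos a3 o1
    linarith

theorem seen_irrefl {V : Finset (ℝ × ℝ)} (h : V.Nonempty) (x : ℝ × ℝ) : ¬ seen V x x := by
  obtain ⟨v, hv⟩ := h
  intro hs
  have := hs v hv
  unfold orient at this
  linarith [mul_comm (x.1 - v.1) (x.2 - v.2)]

theorem seen_sub {V V' : Finset (ℝ × ℝ)} (h : V' ⊆ V) {x y : ℝ × ℝ} (hs : seen V x y) : seen V' x y :=
  fun v hv => hs v (h hv)

/-- Every pair in `U` is comparable from `V` or from `W`. -/
def Cmp (U V W : Finset (ℝ × ℝ)) : Prop :=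
  ∀ x ∈ U, ∀ y ∈ U, x ≠ y → (seen V x y ∨ seen V y x) ∨ (seen W x y ∨ seen W y x)

theorem chain_or {U V W : Finset (ℝ × ℝ)} (h1 : XSep U V) (h2 : XSep U W) (hc : Cmp U V W)
    (hW : W.Nonempty) (p q : ℕ) (hcard : p * q < U.card) :
    HasChain (seen V) U (p + 1) ∨ HasChain (seen W) U (q + 1) := by
  classical
  exact two_orders (seen V) (seen W) q p U (seen_trans h1) (fun x _ => seen_irrefl hW x)
    (seen_trans h2) hc hcard

/-- The configuration that yields `K + 1` spokes. -/
def Good (P : Finset (ℝ × ℝ)) (K : ℕ) : Prop :=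
  ∃ (U V : Finset (ℝ × ℝ)) (a b : ℕ → ℝ × ℝ) (ε : ℝ), U ⊆ P ∧ V ⊆ P ∧ XSep U V ∧ V.Nonempty ∧
    (∀ i < K + 1, a i ∈ U) ∧ (∀ i < K + 1, b i ∈ V) ∧
    (∀ i l, i < l → l < K + 1 → ∀ j < K + 1, 0 < ε * orient (b j) (a i) (a l)) ∧
    (∀ j l, j < l → l < K + 1 → ∀ i < K, 0 < ε * orient (a i) (b j) (b l))

theorem good_of_chains {P U V : Finset (ℝ × ℝ)} {K : ℕ} (hU : U ⊆ P) (hV : V ⊆ P) (hs : XSep U V)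
    (h1 : HasChain (seen V) U (K + 1)) (h2 : HasChain (seen U) V (K + 1)) : Good P K := by
  obtain ⟨a, ha, ha'⟩ := h1
  obtain ⟨b, hb, hb'⟩ := h2
  refine ⟨U, V, a, b, 1, hU, hV, hs, ⟨_, hb 0 (by omega)⟩, ha, hb, ?_, ?_⟩
  · intro i l h h' j hj
    rw [one_mul]
    exact ha' i l h h' (b j) (hb j hj)
  · intro i l h h' j hj
    rw [one_mul]
    exact hb' i l h h' (a j) (ha j (by omega))

/-- The weak version of transitivity used below. -/
theorem orient_step {v w p q : ℝ × ℝ} (h : (w.1 - v.1 ≤ 0 ∧ p.1 - v.1 < 0 ∧ q.1 - v.1 < 0) ∨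
    (0 ≤ w.1 - v.1 ∧ 0 < p.1 - v.1 ∧ 0 < q.1 - v.1)) (h1 : 0 < orient v w p)
    (h2 : 0 < orient v p q) : 0 < orient v w q := by
  have e := orient_tri v w p q
  rcases h with ⟨a1, a2, a3⟩ | ⟨a1, a2, a3⟩
  · by_contra hc
    push Not at hc
    have := mul_nonneg_of_nonpos_of_nonpos a2.le hc
    have := mul_nonpos_of_nonpos_of_nonneg a1 h2.le
    have := mul_neg_of_neg_of_pos a3 h1
    linarith
  · by_contra hc
    push Not at hc
    have := mul_nonpos_of_nonneg_of_nonpos a2.le hc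
    have := mul_nonneg a1 h2.le
    have := mul_pos a3 h1
    linarith

theorem sep_ne {U V : Finset (ℝ × ℝ)} (h : XSep U V) {u v : ℝ × ℝ} (hu : u ∈ U) (hv : v ∈ V) : u ≠ v := by
  rintro rfl
  rcases h with h | h
  · exact lt_irrefl _ (h u hu u hv)
  · exact lt_irrefl _ (h u hu u hv)

theorem half_case {P A B C : Finset (ℝ × ℝ)} {K : ℕ} (hK : 1 ≤ K) (hg : GenPos (P : Set (ℝ × ℝ)))
    (hA : A ⊆ P) (hC : C ⊆ P) (hAB : XSep A B) (hAC : XSep A C)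
    (hcmp : Cmp A C B) (hBne : B.Nonempty)
    (hAc : (2 * K - 1) * K < A.card) (hCc : K * K < C.card)
    (hno : ¬ HasChain (seen B) A (K + 1)) : Good P K := by
  classical
  obtain ⟨a, ha, ha'⟩ := (chain_or hAC hAB hcmp hBne (2 * K - 1) K hAc).resolve_right hno
  rw [show 2 * K - 1 + 1 = 2 * K by omega] at ha ha'
  set A1 := (Finset.range K).image a with hA1
  set A2 := (Finset.Ico K (2 * K)).image a with hA2
  have hA1s : A1 ⊆ A := by
    intro x hx
    obtain ⟨i, hi, rfl⟩ := Finset.mem_image.mp hx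
    exact ha i (by have := Finset.mem_range.mp hi; omega)
  have hA2s : A2 ⊆ A := by
    intro x hx
    obtain ⟨i, hi, rfl⟩ := Finset.mem_image.mp hx
    exact ha i (by have := Finset.mem_Ico.mp hi; omega)
  have hsub : ∀ {A' : Finset (ℝ × ℝ)}, A' ⊆ A → XSep C A' := by
    intro A' h
    rcases hAC with hh | hh
    · exact Or.inr (fun c hc x hx => hh x (h hx) c hc)
    · exact Or.inl (fun c hc x hx => hh x (h hx) c hc)
  have main : ∀ v ∈ C, ∀ w ∈ C, v ≠ w →
      ((∀ x ∈ A, w.1 - v.1 ≤ 0 ∧ x.1 - v.1 < 0) ∨ (∀ x ∈ A, 0 ≤ w.1 - v.1 ∧ 0 < x.1 - v.1)) →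
      seen A2 v w ∨ seen A1 w v := by
    intro v hv w hw hvw hx
    have hstep : ∀ i l, i < l → l < 2 * K → 0 < orient v w (a i) → 0 < orient v w (a l) := by
      intro i l hil hl h0
      refine orient_step ?_ h0 (ha' i l hil hl v hv)
      have m1 := ha i (by omega)
      have m2 := ha l hl
      rcases hx with hx | hx
      · exact Or.inl ⟨(hx _ m1).1, (hx _ m1).2, (hx _ m2).2⟩
      · exact Or.inr ⟨(hx _ m1).1, (hx _ m1).2, (hx _ m2).2⟩
    by_cases h : 0 < orient v w (a K)
    · left
      intro x hx
      obtain ⟨i, hi, rfl⟩ := Finset.mem_image.mp hx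
      have := Finset.mem_Ico.mp hi
      rw [← orient_cyc]
      rcases Nat.eq_or_lt_of_le this.1 with e | e
      · rw [← e]; exact h
      · exact hstep K i e this.2 h
    · right
      intro x hx
      obtain ⟨i, hi, rfl⟩ := Finset.mem_image.mp hx
      have := Finset.mem_range.mp hi
      have m1 := ha i (by omega)
      have hle : orient v w (a i) ≤ 0 := by
        by_contra hc
        push Not at hc
        exact h (hstep i K this (by omega) hc)
      have hne : orient v w (a i) ≠ 0 :=
        orient_ne_zero hg (hC hv) (hC hw) (hA m1) hvw (sep_ne hAC m1 hv).symm (sep_ne hAC m1 hw).symm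
      have hlt := lt_of_le_of_ne hle hne
      rw [orient_cyc, orient_swap] at hlt
      linarith
  have hcmp' : Cmp C A1 A2 := by
    intro x hx y hy hxy
    have hh : (seen A2 x y ∨ seen A1 y x) ∨ (seen A2 y x ∨ seen A1 x y) := by
      rcases hAC with h | h
      · rcases le_total x.1 y.1 with hl | hl
        · right
          exact main y hy x hx hxy.symm (Or.inl (fun z hz => ⟨by linarith, by linarith [h z hz y hy]⟩))
        · left
          exact main x hx y hy hxy (Or.inl (fun z hz => ⟨by linarith, by linarith [h z hz x hx]⟩))
      · rcases le_total x.1 y.1 with hl | hl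
        · left
          exact main x hx y hy hxy (Or.inr (fun z hz => ⟨by linarith, by linarith [h z hz x hx]⟩))
        · right
          exact main y hy x hx hxy.symm (Or.inr (fun z hz => ⟨by linarith, by linarith [h z hz y hy]⟩))
    tauto
  have hA2ne : A2.Nonempty := ⟨a K, Finset.mem_image_of_mem _ (Finset.mem_Ico.mpr ⟨le_rfl, by omega⟩)⟩
  rcases chain_or (hsub hA1s) (hsub hA2s) hcmp' hA2ne K K hCc with ⟨b, hb, hb'⟩ | ⟨b, hb, hb'⟩
  · refine ⟨A, C, a, b, 1, hA, hC, hAC, ⟨_, hb 0 (by omega)⟩, fun i hi => ha i (by omega), hb, ?_, ?_⟩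
    · intro i l h h' j hj
      rw [one_mul]
      exact ha' i l h (by omega) (b j) (hb j hj)
    · intro i l h h' j hj
      rw [one_mul]
      exact hb' i l h h' (a j) (Finset.mem_image_of_mem _ (Finset.mem_range.mpr hj))
  · refine ⟨A, C, fun i => a (2 * K - 1 - i), fun j => b (K - j), -1, hA, hC, hAC,
      ⟨_, hb 0 (by omega)⟩, fun i hi => ha _ (by omega), fun i hi => hb _ (by omega), ?_, ?_⟩
    · intro i l h h' j hj
      have := ha' (2 * K - 1 - l) (2 * K - 1 - i) (by omega) (by omega) (b (K - j)) (hb _ (by omega))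
      rw [orient_swap]
      simp only
      linarith
    · intro i l h h' j hj
      have := hb' (K - l) (K - i) (by omega) (by omega) (a (2 * K - 1 - j))
        (Finset.mem_image_of_mem _ (Finset.mem_Ico.mpr (by omega)))
      rw [orient_swap]
      simp only
      linarith

theorem stage_two {P A B C : Finset (ℝ × ℝ)} {K : ℕ} (hK : 1 ≤ K) (hg : GenPos (P : Set (ℝ × ℝ)))
    (hA : A ⊆ P) (hB : B ⊆ P) (hC : C ⊆ P) (hAB : XSep A B) (hAC : XSep A C) (hBC : XSep B C)
    (cA : Cmp A B C) (cB : Cmp B A C) (cC : Cmp C A B)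
    (hAc : (2 * K - 1) * K < A.card) (hBc : K * K < B.card) (hCc : K * K < C.card) : Good P K := by
  have nA : A.Nonempty := Finset.card_pos.mp (by omega)
  have nB : B.Nonempty := Finset.card_pos.mp (by omega)
  have nC : C.Nonempty := Finset.card_pos.mp (by omega)
  by_cases h1 : HasChain (seen B) A (K + 1)
  swap
  · exact half_case hK hg hA hC hAB hAC (fun x hx y hy h => (cA x hx y hy h).symm) nB hAc hCc h1
  by_cases h2 : HasChain (seen C) A (K + 1)
  swap
  · exact half_case hK hg hA hB hAC hAB cA nC hAc hBc h2
  rcases chain_or hAB.symm hBC cB nC K K hBc with h3 | h3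
  · exact good_of_chains hA hB hAB h1 h3
  rcases chain_or hAC.symm hBC.symm cC nB K K hCc with h4 | h4
  · exact good_of_chains hA hC hAC h2 h4
  exact good_of_chains hB hC hBC h3 h4

theorem sep_line {U V : Finset (ℝ × ℝ)} (h : XSep U V) (hV : V.Nonempty) : ∃ l : ℝ × ℝ × ℝ,
    (∀ u ∈ U, sideVal l u < 0) ∧ ∀ v ∈ V, 0 ≤ sideVal l v := by
  rcases h with h | h
  · obtain ⟨w, hw, hmin⟩ := Finset.exists_min_image V (fun v => v.1) hV
    refine ⟨(1, 0, w.1), ?_, ?_⟩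
    · intro u hu
      have := h u hu w hw
      simp only [sideVal]; linarith
    · intro u hu
      have := hmin u hu
      simp only [sideVal]; linarith
  · obtain ⟨w, hw, hmin⟩ := Finset.exists_max_image V (fun v => v.1) hV
    refine ⟨(-1, 0, -w.1), ?_, ?_⟩
    · intro u hu
      have := h u hu w hw
      simp only [sideVal]; linarith
    · intro u hu
      have := hmin u hu
      simp only [sideVal]; linarith

/-- The functional `x ↦ -ε * orient b a x`. -/
def orLine (ε : ℝ) (b a : ℝ × ℝ) : ℝ × ℝ × ℝ :=
  (ε * (a.2 - b.2), -ε * (a.1 - b.1), ε * ((a.2 - b.2) * b.1 - (a.1 - b.1) * b.2))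

theorem sideVal_orLine (ε : ℝ) (b a x : ℝ × ℝ) : sideVal (orLine ε b a) x = -(ε * orient b a x) := by
  simp only [sideVal, orLine, orient]
  ring

/-- The abstract spoke data. -/
def Spokes (P : Finset (ℝ × ℝ)) (k : ℕ) : Prop :=
  ∃ (f : Fin k → ℝ × ℝ × ℝ) (a b : Fin k → ℝ × ℝ), (∀ i, a i ∈ P) ∧ (∀ i, b i ∈ P) ∧
    (∀ i, sideVal (f i) (a i) < 0) ∧ (∀ i, 0 ≤ sideVal (f i) (b i)) ∧
    (∀ i j, i ≠ j → PairOK f a b i j ∨ PairOK f a b j i)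

theorem spokes_of_good {P : Finset (ℝ × ℝ)} {K : ℕ} (h : Good P K) : Spokes P (K + 1) := by
  obtain ⟨U, V, a, b, ε, hU, hV, hs, hne, ha, hb, h1, h2⟩ := h
  obtain ⟨l, hl1, hl2⟩ := sep_line hs hne
  set f : ℕ → ℝ × ℝ × ℝ := fun i => if i = 0 then l else orLine ε (b i) (a (i - 1)) with hf
  have f0 : f 0 = l := by simp [hf]
  have fs : ∀ i, f (i + 1) = orLine ε (b (i + 1)) (a i) := by intro i; simp [hf]
  have A1 : ∀ i j, i ≤ j → j < K + 1 → sideVal (f i) (a j) < 0 := by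
    intro i j hij hj
    cases i with
    | zero => rw [f0]; exact hl1 _ (ha j hj)
    | succ i =>
      rw [fs, sideVal_orLine]
      have := h1 i j (by omega) hj (i + 1) (by omega)
      linarith
  have A2 : ∀ i j, j < i → i < K + 1 → 0 ≤ sideVal (f i) (a j) := by
    intro i j hij hi
    cases i with
    | zero => omega
    | succ i =>
      rw [fs, sideVal_orLine]
      rcases Nat.eq_or_lt_of_le (show j ≤ i by omega) with e | e
      · rw [e]
        have : orient (b (i + 1)) (a i) (a i) = 0 := by unfold orient; ring
        rw [this]; simp
      · have := h1 j i e (by omega) (i + 1) (by omega)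
        rw [orient_swap]
        linarith
  have B1 : ∀ i j, i ≤ j → j < K + 1 → 0 ≤ sideVal (f i) (b j) := by
    intro i j hij hj
    cases i with
    | zero => rw [f0]; exact hl2 _ (hb j hj)
    | succ i =>
      rw [fs, sideVal_orLine]
      rcases Nat.eq_or_lt_of_le hij with e | e
      · rw [e]
        have : orient (b j) (a i) (b j) = 0 := by unfold orient; ring
        rw [this]; simp
      · have := h2 (i + 1) j e hj i (by omega)
        have e2 : orient (b (i + 1)) (a i) (b j) = - orient (a i) (b (i + 1)) (b j) := by
          unfold orient; ring
        rw [e2]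
        linarith
  have B2 : ∀ i j, j < i → i < K + 1 → sideVal (f i) (b j) < 0 := by
    intro i j hij hi
    cases i with
    | zero => omega
    | succ i =>
      rw [fs, sideVal_orLine]
      have := h2 j (i + 1) hij hi i (by omega)
      rw [orient_cyc] at this
      linarith
  refine ⟨fun i => f i, fun i => a i, fun i => b i, fun i => hU (ha i i.2), fun i => hV (hb i i.2),
    fun i => A1 i i le_rfl i.2, fun i => B1 i i le_rfl i.2, ?_⟩
  have key : ∀ i j : Fin (K + 1), i < j →
      PairOK (fun i : Fin (K + 1) => f i) (fun i => a i) (fun i => b i) i j := by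
    intro i j hij
    exact ⟨A1 i j hij.le j.2, B1 i j hij.le j.2, A2 j i hij j.2, B2 j i hij j.2⟩
  intro i j hij
  rcases lt_or_gt_of_ne hij with h | h
  · exact Or.inl (key i j h)
  · exact Or.inr (key j i h)

/-- The hull of `V` meets the line through `x`, `y`. -/
def Hits (V : Finset (ℝ × ℝ)) (x y : ℝ × ℝ) : Prop :=
  ∃ p : ℝ × ℝ, orient p x y = 0 ∧ (∀ l, (∀ v ∈ V, sideVal l v < 0) → sideVal l p < 0) ∧
    (∀ l, (∀ v ∈ V, sideVal l v ≤ 0) → sideVal l p ≤ 0)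

theorem hits_self {V : Finset (ℝ × ℝ)} {x y : ℝ × ℝ} (hx : x ∈ V) : Hits V x y :=
  ⟨x, by unfold orient; ring, fun _ h => h x hx, fun _ h => h x hx⟩

theorem orient_comb (p q x y : ℝ × ℝ) (s t : ℝ) (h : s + t = 1) :
    orient (s • p + t • q) x y = s * orient p x y + t * orient q x y := by
  unfold orient
  simp only [Prod.fst_add, Prod.smul_fst, Prod.snd_add, Prod.smul_snd, smul_eq_mul]
  have : s = 1 - t := by linarith
  subst this
  ring

theorem hits_of_not_seen {V : Finset (ℝ × ℝ)} {x y : ℝ × ℝ} (h1 : ¬ seen V x y) (h2 : ¬ seen V y x) :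
    Hits V x y := by
  unfold seen at h1 h2
  push Not at h1 h2
  obtain ⟨v, hv, g1⟩ := h1
  obtain ⟨w, hw, g2⟩ := h2
  rw [orient_swap] at g2
  have g3 : 0 ≤ orient w x y := by linarith
  obtain ⟨s, t, hs, ht, hst, he⟩ : ∃ s t : ℝ, 0 ≤ s ∧ 0 ≤ t ∧ s + t = 1 ∧
      s * orient v x y + t * orient w x y = 0 := by
    by_cases h0 : orient v x y = 0
    · exact ⟨1, 0, by norm_num, le_rfl, by norm_num, by rw [h0]; ring⟩
    · have hlt : orient v x y < 0 := lt_of_le_of_ne g1 h0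
      have hd : 0 < orient w x y - orient v x y := by linarith
      refine ⟨orient w x y / (orient w x y - orient v x y),
        -orient v x y / (orient w x y - orient v x y), by positivity,
        div_nonneg (by linarith) hd.le, ?_, ?_⟩
      · field_simp; ring
      · field_simp; ring
  refine ⟨s • v + t • w, by rw [orient_comb _ _ _ _ _ _ hst, he], ?_, ?_⟩
  · intro l hl
    rw [sideVal_comb _ _ _ _ _ hst]
    have a1 := hl v hv
    have a2 := hl w hw
    rcases hs.eq_or_lt with h | h
    · have : t = 1 := by linarith
      rw [← h, this]; linarith
    · have := mul_neg_of_pos_of_neg h a1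
      have := mul_nonpos_of_nonneg_of_nonpos ht a2.le
      linarith
  · intro l hl
    rw [sideVal_comb _ _ _ _ _ hst]
    have := mul_nonpos_of_nonneg_of_nonpos hs (hl v hv)
    have := mul_nonpos_of_nonneg_of_nonpos ht (hl w hw)
    linarith

theorem line_between {x y a b c : ℝ × ℝ} (hxy : x ≠ y) (ha : orient a x y = 0) (hb : orient b x y = 0)
    (hc : orient c x y = 0) (h1 : b.1 < a.1) (h2 : a.1 < c.1) (l : ℝ × ℝ × ℝ)
    (hlb : sideVal l b ≤ 0) (hlc : sideVal l c ≤ 0) : sideVal l a ≤ 0 := by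
  have hD : y.1 - x.1 ≠ 0 := by
    intro h0
    have hy : y.1 = x.1 := by linarith
    have h2' : y.2 - x.2 ≠ 0 := by
      intro h
      exact hxy (Prod.ext (by linarith) (by linarith))
    unfold orient at ha hb
    rw [hy] at ha hb
    have ea : (x.1 - a.1) * (y.2 - x.2) = 0 := by linarith
    have eb : (x.1 - b.1) * (y.2 - x.2) = 0 := by linarith
    have ea' := (mul_eq_zero.mp ea).resolve_right h2'
    have eb' := (mul_eq_zero.mp eb).resolve_right h2'
    linarith
  have e : (c.1 - b.1) * a.2 = (c.1 - a.1) * b.2 + (a.1 - b.1) * c.2 := by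
    apply mul_left_cancel₀ hD
    unfold orient at ha hb hc
    linear_combination (c.1 - b.1) * ha - (c.1 - a.1) * hb - (a.1 - b.1) * hc
  have e2 : (c.1 - b.1) * sideVal l a = (c.1 - a.1) * sideVal l b + (a.1 - b.1) * sideVal l c := by
    unfold sideVal
    linear_combination l.2.1 * e
  by_contra hcon
  push Not at hcon
  have := mul_pos (show 0 < c.1 - b.1 by linarith) hcon
  have := mul_nonpos_of_nonneg_of_nonpos (show 0 ≤ c.1 - a.1 by linarith) hlb
  have := mul_nonpos_of_nonneg_of_nonpos (show 0 ≤ a.1 - b.1 by linarith) hlc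
  linarith

theorem hits_lt {U V : Finset (ℝ × ℝ)} (h : ∀ u ∈ U, ∀ v ∈ V, u.1 < v.1) {p q : ℝ × ℝ}
    (hp : ∀ l, (∀ v ∈ U, sideVal l v < 0) → sideVal l p < 0)
    (hq : ∀ l, (∀ v ∈ V, sideVal l v < 0) → sideVal l q < 0) : p.1 < q.1 := by
  have h1 : ∀ v ∈ V, p.1 < v.1 := by
    intro v hv
    have := hp (1, 0, v.1) (by
      intro u hu
      have := h u hu v hv
      simp only [sideVal]; linarith)
    simp only [sideVal] at this
    linarith
  have := hq (-1, 0, -p.1) (by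
    intro v hv
    have := h1 v hv
    simp only [sideVal]; linarith)
  simp only [sideVal] at this
  linarith

theorem no_three {A B C : Finset (ℝ × ℝ)} (hBA : ∀ b ∈ B, ∀ a ∈ A, b.1 < a.1)
    (hAC : ∀ a ∈ A, ∀ c ∈ C, a.1 < c.1) (l : ℝ × ℝ × ℝ) (hA : ∀ a ∈ A, 0 < sideVal l a)
    (hB : ∀ b ∈ B, sideVal l b ≤ 0) (hC : ∀ c ∈ C, sideVal l c ≤ 0) {x y : ℝ × ℝ} (hxy : x ≠ y)
    (kA : Hits A x y) (kB : Hits B x y) (kC : Hits C x y) : False := by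
  obtain ⟨a, a1, a2, a3⟩ := kA
  obtain ⟨b, b1, b2, b3⟩ := kB
  obtain ⟨c, c1, c2, c3⟩ := kC
  have h := line_between hxy a1 b1 c1 (hits_lt hBA b2 a2) (hits_lt hAC a2 c2) l (b3 l hB) (c3 l hC)
  have neg : ∀ z, sideVal (-l.1, -l.2.1, -l.2.2) z = - sideVal l z := by
    intro z; simp only [sideVal]; ring
  have := a2 (-l.1, -l.2.1, -l.2.2) (by
    intro v hv
    rw [neg]
    linarith [hA v hv])
  rw [neg] at this
  linarith

theorem good_of_layout {P A B C : Finset (ℝ × ℝ)} {K : ℕ} (hK : 1 ≤ K) (hg : GenPos (P : Set (ℝ × ℝ)))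
    (hAP : A ⊆ P) (hBP : B ⊆ P) (hCP : C ⊆ P) (hBA : ∀ b ∈ B, ∀ a ∈ A, b.1 < a.1)
    (hAC : ∀ a ∈ A, ∀ c ∈ C, a.1 < c.1) (hBC : ∀ b ∈ B, ∀ c ∈ C, b.1 < c.1)
    (l : ℝ × ℝ × ℝ) (hA : ∀ a ∈ A, 0 < sideVal l a)
    (hB : ∀ b ∈ B, sideVal l b ≤ 0) (hC : ∀ c ∈ C, sideVal l c ≤ 0)
    (hAc : (2 * K - 1) * K < A.card) (hBc : K * K < B.card) (hCc : K * K < C.card) : Good P K := by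
  refine stage_two hK hg hAP hBP hCP (Or.inr (fun a ha b hb => hBA b hb a ha)) (Or.inl hAC) (Or.inl hBC)
    ?_ ?_ ?_ hAc hBc hCc
  · intro x hx y hy hxy
    by_contra hcon
    push Not at hcon
    exact no_three hBA hAC l hA hB hC hxy (hits_self hx)
      (hits_of_not_seen hcon.1.1 hcon.1.2) (hits_of_not_seen hcon.2.1 hcon.2.2)
  · intro x hx y hy hxy
    by_contra hcon
    push Not at hcon
    exact no_three hBA hAC l hA hB hC hxy
      (hits_of_not_seen hcon.1.1 hcon.1.2) (hits_self hx) (hits_of_not_seen hcon.2.1 hcon.2.2)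
  · intro x hx y hy hxy
    by_contra hcon
    push Not at hcon
    exact no_three hBA hAC l hA hB hC hxy
      (hits_of_not_seen hcon.1.1 hcon.1.2) (hits_of_not_seen hcon.2.1 hcon.2.2) (hits_self hx)

/-- A continuous selection of the median. -/
theorem exists_median (X : Finset (ℝ × ℝ)) (m : ℕ) (hX : X.card = 2 * m + 1) :
    ∃ M : ℝ → ℝ, Continuous M ∧ ∀ α, (∃ p ∈ X, M α = p.2 - α * p.1) ∧
      m + 1 ≤ (X.filter (fun p => p.2 - α * p.1 ≤ M α)).card ∧
      m + 1 ≤ (X.filter (fun p => M α ≤ p.2 - α * p.1)).card := by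
  classical
  have hne : (X.powersetCard (m + 1)).attach.Nonempty := by
    rw [Finset.attach_nonempty_iff]
    exact Finset.powersetCard_nonempty.mpr (by omega)
  have hT : ∀ T : {T // T ∈ X.powersetCard (m + 1)}, T.1.Nonempty := by
    intro T
    have := (Finset.mem_powersetCard.mp T.2).2
    exact Finset.card_pos.mp (by omega)
  refine ⟨fun α => (X.powersetCard (m + 1)).attach.inf' hne
    (fun T => T.1.sup' (hT T) (fun p => p.2 - α * p.1)), ?_, ?_⟩
  · apply Continuous.finset_inf'_apply
    intro T _
    apply Continuous.finset_sup'_apply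
    intro p _
    fun_prop
  · intro α
    set M := (X.powersetCard (m + 1)).attach.inf' hne
      (fun T => T.1.sup' (hT T) (fun p => p.2 - α * p.1)) with hM
    obtain ⟨T, _, hTe⟩ := Finset.exists_mem_eq_inf' hne
      (fun T : {T // T ∈ X.powersetCard (m + 1)} => T.1.sup' (hT T) (fun p => p.2 - α * p.1))
    obtain ⟨hTX, hTc⟩ := Finset.mem_powersetCard.mp T.2
    show (∃ p ∈ X, M = p.2 - α * p.1) ∧ m + 1 ≤ (X.filter (fun p => p.2 - α * p.1 ≤ M)).card ∧
      m + 1 ≤ (X.filter (fun p => M ≤ p.2 - α * p.1)).card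
    have hTe' : M = T.1.sup' (hT T) (fun p => p.2 - α * p.1) := hTe
    have hinf : ∀ S : {T // T ∈ X.powersetCard (m + 1)}, M ≤ S.1.sup' (hT S) (fun p => p.2 - α * p.1) :=
      fun S => Finset.inf'_le (fun T : {T // T ∈ X.powersetCard (m + 1)} =>
          T.1.sup' (hT T) (fun p => p.2 - α * p.1)) (Finset.mem_attach _ S)
    clear_value M
    refine ⟨?_, ?_, ?_⟩
    · obtain ⟨p, hp, hpe⟩ := Finset.exists_mem_eq_sup' (hT T) (fun p : ℝ × ℝ => p.2 - α * p.1)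
      exact ⟨p, hTX hp, by rw [hTe', hpe]⟩
    · rw [← hTc]
      apply Finset.card_le_card
      intro p hp
      rw [Finset.mem_filter]
      refine ⟨hTX hp, ?_⟩
      rw [hTe']
      exact Finset.le_sup' (fun p : ℝ × ℝ => p.2 - α * p.1) hp
    · by_contra hcon
      have hsum := Finset.card_filter_add_card_filter_not (s := X) (fun p => M ≤ p.2 - α * p.1)
      obtain ⟨S, hS, hSc⟩ := Finset.exists_subset_card_eq
        (show m + 1 ≤ (X.filter (fun p => ¬ M ≤ p.2 - α * p.1)).card by omega)
      have hSm : S ∈ X.powersetCard (m + 1) :=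
        Finset.mem_powersetCard.mpr ⟨hS.trans (Finset.filter_subset _ _), hSc⟩
      have h1 : M ≤ S.sup' (hT ⟨S, hSm⟩) (fun p => p.2 - α * p.1) :=
        hinf ⟨S, hSm⟩
      have h2 : S.sup' (hT ⟨S, hSm⟩) (fun p => p.2 - α * p.1) < M := by
        rw [Finset.sup'_lt_iff]
        intro p hp
        exact not_le.mp (Finset.mem_filter.mp (hS hp)).2
      linarith

theorem median_line (X Z : Finset (ℝ × ℝ)) (m : ℕ) (hX : X.card = 2 * m + 1) (hZ : Z.card = 2 * m + 1)
    (hXZ : ∀ x ∈ X, ∀ z ∈ Z, x.1 < z.1) :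
    ∃ l : ℝ × ℝ × ℝ, (∃ x ∈ X, sideVal l x = 0) ∧ (∃ z ∈ Z, sideVal l z = 0) ∧ l.2.1 ≠ 0 ∧
      m + 1 ≤ (X.filter (fun p => sideVal l p ≤ 0)).card ∧
      m + 1 ≤ (X.filter (fun p => 0 ≤ sideVal l p)).card ∧
      m + 1 ≤ (Z.filter (fun p => sideVal l p ≤ 0)).card ∧
      m + 1 ≤ (Z.filter (fun p => 0 ≤ sideVal l p)).card := by
  obtain ⟨M, hMc, hM⟩ := exists_median X m hX
  obtain ⟨N, hNc, hN⟩ := exists_median Z m hZ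
  have top : ∃ α, N α ≤ M α := by
    have : ∀ᶠ α : ℝ in Filter.atTop, ∀ x ∈ X, ∀ z ∈ Z, z.2 - α * z.1 < x.2 - α * x.1 := by
      rw [Filter.eventually_all_finset]
      intro x hx
      rw [Filter.eventually_all_finset]
      intro z hz
      filter_upwards [Filter.eventually_gt_atTop ((z.2 - x.2) / (z.1 - x.1))] with α hα
      rw [div_lt_iff₀ (by linarith [hXZ x hx z hz])] at hα
      linarith
    obtain ⟨α, hα⟩ := this.exists
    obtain ⟨x, hx, ex⟩ := (hM α).1
    obtain ⟨z, hz, ez⟩ := (hN α).1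
    exact ⟨α, by rw [ex, ez]; exact (hα x hx z hz).le⟩
  have bot : ∃ α, M α ≤ N α := by
    have : ∀ᶠ α : ℝ in Filter.atBot, ∀ x ∈ X, ∀ z ∈ Z, x.2 - α * x.1 < z.2 - α * z.1 := by
      rw [Filter.eventually_all_finset]
      intro x hx
      rw [Filter.eventually_all_finset]
      intro z hz
      filter_upwards [Filter.eventually_lt_atBot ((z.2 - x.2) / (z.1 - x.1))] with α hα
      rw [lt_div_iff₀ (by linarith [hXZ x hx z hz])] at hα
      linarith
    obtain ⟨α, hα⟩ := this.exists
    obtain ⟨x, hx, ex⟩ := (hM α).1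
    obtain ⟨z, hz, ez⟩ := (hN α).1
    exact ⟨α, by rw [ex, ez]; exact (hα x hx z hz).le⟩
  obtain ⟨α1, h1⟩ := top
  obtain ⟨α2, h2⟩ := bot
  obtain ⟨α, hα⟩ := mem_range_of_exists_le_of_exists_ge (hMc.sub hNc) (c := 0)
    ⟨α2, by simp only [Pi.sub_apply]; linarith⟩ ⟨α1, by simp only [Pi.sub_apply]; linarith⟩
  have hMN : N α = M α := by
    simp only [Pi.sub_apply] at hα
    linarith
  have sv : ∀ p : ℝ × ℝ, sideVal (-α, 1, M α) p = p.2 - α * p.1 - M α := by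
    intro p; simp only [sideVal]; ring
  have e1 : ∀ p : ℝ × ℝ, sideVal (-α, 1, M α) p ≤ 0 ↔ p.2 - α * p.1 ≤ M α := by
    intro p; rw [sv]; exact sub_nonpos
  have e2 : ∀ p : ℝ × ℝ, 0 ≤ sideVal (-α, 1, M α) p ↔ M α ≤ p.2 - α * p.1 := by
    intro p; rw [sv]; exact sub_nonneg
  obtain ⟨⟨x, hx, ex⟩, m1, m2⟩ := hM α
  obtain ⟨⟨z, hz, ez⟩, m3, m4⟩ := hN α
  rw [hMN] at ez m3 m4
  refine ⟨(-α, 1, M α), ⟨x, hx, by rw [sv]; linarith⟩, ⟨z, hz, by rw [sv]; linarith⟩, one_ne_zero, ?_⟩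
  simp only [e1, e2]
  exact ⟨m1, m2, m3, m4⟩

theorem take_min (f : ℝ × ℝ → ℝ) (P : Finset (ℝ × ℝ)) (hf : Set.InjOn f P) (N : ℕ) (hN : N ≤ P.card) :
    ∃ X ⊆ P, X.card = N ∧ ∀ x ∈ X, ∀ y ∈ P, y ∉ X → f x < f y := by
  classical
  induction N with
  | zero => exact ⟨∅, by simp, rfl, by simp⟩
  | succ N ih =>
    obtain ⟨X, hXP, hXc, hX⟩ := ih (by omega)
    have hne : (P \ X).Nonempty := by
      rw [← Finset.card_pos, Finset.card_sdiff_of_subset hXP]; omega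
    obtain ⟨w, hw, hmin⟩ := Finset.exists_min_image (P \ X) f hne
    obtain ⟨hwP, hwX⟩ := Finset.mem_sdiff.mp hw
    refine ⟨insert w X, ?_, by rw [Finset.card_insert_of_notMem hwX, hXc], ?_⟩
    · intro x hx
      rcases Finset.mem_insert.mp hx with rfl | hx
      · exact hwP
      · exact hXP hx
    · intro x hx y hy hyX
      rw [Finset.mem_insert, not_or] at hyX
      rcases Finset.mem_insert.mp hx with rfl | hx
      · refine lt_of_le_of_ne (hmin y (Finset.mem_sdiff.mpr ⟨hy, hyX.2⟩)) ?_
        intro h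
        exact hyX.1 (hf hwP hy h).symm
      · exact hX x hx y hy hyX.2

theorem good_of_inj {P : Finset (ℝ × ℝ)} {K : ℕ} (hK : 1 ≤ K) (hg : GenPos (P : Set (ℝ × ℝ)))
    (hinj : Set.InjOn (fun p : ℝ × ℝ => p.1) (P : Set (ℝ × ℝ))) (hc : 8 * (K * K) + 1 ≤ P.card) :
    Good P K := by
  classical
  set m := K * K with hm
  have hKm : K ≤ m := Nat.le_mul_self K
  obtain ⟨X, hXP, hXc, hX⟩ := take_min (fun p => p.1) P hinj (2 * m + 1) (by omega)
  have hcard1 : (P \ X).card = P.card - (2 * m + 1) := by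
    rw [Finset.card_sdiff_of_subset hXP, hXc]
  obtain ⟨Z, hZP, hZc, hZ⟩ := take_min (fun p => -p.1) (P \ X) (by
    intro p hp q hq h
    have hp' := (Finset.mem_sdiff.mp (Finset.mem_coe.mp hp)).1
    have hq' := (Finset.mem_sdiff.mp (Finset.mem_coe.mp hq)).1
    exact hinj hp' hq' (neg_injective h)) (2 * m + 1) (by omega)
  set Y := (P \ X) \ Z with hY
  have hYc : 4 * m - 1 ≤ Y.card := by
    rw [hY, Finset.card_sdiff_of_subset hZP, hZc]; omega
  have hYm : ∀ y ∈ Y, y ∈ P ∧ y ∉ X ∧ y ∉ Z := by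
    intro y hy
    rw [hY, Finset.mem_sdiff, Finset.mem_sdiff] at hy
    exact ⟨hy.1.1, hy.1.2, hy.2⟩
  have hZm : ∀ z ∈ Z, z ∈ P ∧ z ∉ X := fun z hz => Finset.mem_sdiff.mp (hZP hz)
  have hXY : ∀ x ∈ X, ∀ y ∈ Y, x.1 < y.1 := fun x hx y hy => hX x hx y (hYm y hy).1 (hYm y hy).2.1
  have hXZ : ∀ x ∈ X, ∀ z ∈ Z, x.1 < z.1 := fun x hx z hz => hX x hx z (hZm z hz).1 (hZm z hz).2
  have hYZ : ∀ y ∈ Y, ∀ z ∈ Z, y.1 < z.1 := by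
    intro y hy z hz
    obtain ⟨h1, h2, h3⟩ := hYm y hy
    have := hZ z hz y (Finset.mem_sdiff.mpr ⟨h1, h2⟩) h3
    linarith
  obtain ⟨l, ⟨x, hx, ex⟩, ⟨z, hz, ez⟩, hl0, c1, c2, c3, c4⟩ := median_line X Z m hXc hZc hXZ
  have hYn : ∀ y ∈ Y, sideVal l y ≠ 0 := by
    intro y hy ey
    have h1 := hXY x hx y hy
    have h2 := hYZ y hy z hz
    have h3 := hXZ x hx z hz
    refine orient_ne_zero hg (hXP hx) (hYm y hy).1 (hZm z hz).1 ?_ ?_ ?_ ?_ (p := x) (q := y) (r := z)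
    · rintro rfl; linarith
    · rintro rfl; linarith
    · rintro rfl; linarith
    · apply mul_left_cancel₀ hl0
      unfold sideVal at ex ey ez
      unfold orient
      linear_combination (y.1 - x.1) * ez - (z.1 - x.1) * ey + (z.1 - y.1) * ex
  have hsum := Finset.card_filter_add_card_filter_not (s := Y) (fun p => 0 < sideVal l p)
  have hprod : (2 * K - 1) * K < 2 * m := by
    rw [hm]
    have : (2 * K - 1) * K + K = 2 * (K * K) := by
      obtain ⟨k, rfl⟩ : ∃ k, K = k + 1 := ⟨K - 1, by omega⟩
      rw [show 2 * (k + 1) - 1 = 2 * k + 1 by omega]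
      ring
    omega
  by_cases hpos : 2 * m ≤ (Y.filter (fun p => 0 < sideVal l p)).card
  · refine good_of_layout hK hg (A := Y.filter (fun p => 0 < sideVal l p))
      (B := X.filter (fun p => sideVal l p ≤ 0)) (C := Z.filter (fun p => sideVal l p ≤ 0))
      ?_ ?_ ?_ ?_ ?_ ?_ l ?_ ?_ ?_ (by omega) (by omega) (by omega)
    · exact fun p hp => (hYm p (Finset.mem_filter.mp hp).1).1
    · exact fun p hp => hXP (Finset.mem_filter.mp hp).1
    · exact fun p hp => (hZm p (Finset.mem_filter.mp hp).1).1
    · exact fun p hp q hq => hXY p (Finset.mem_filter.mp hp).1 q (Finset.mem_filter.mp hq).1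
    · exact fun p hp q hq => hYZ p (Finset.mem_filter.mp hp).1 q (Finset.mem_filter.mp hq).1
    · exact fun p hp q hq => hXZ p (Finset.mem_filter.mp hp).1 q (Finset.mem_filter.mp hq).1
    · exact fun p hp => (Finset.mem_filter.mp hp).2
    · exact fun p hp => (Finset.mem_filter.mp hp).2
    · exact fun p hp => (Finset.mem_filter.mp hp).2
  · have neg : ∀ z, sideVal (-l.1, -l.2.1, -l.2.2) z = - sideVal l z := by
      intro z; simp only [sideVal]; ring
    refine good_of_layout hK hg (A := Y.filter (fun p => ¬ 0 < sideVal l p))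
      (B := X.filter (fun p => 0 ≤ sideVal l p)) (C := Z.filter (fun p => 0 ≤ sideVal l p))
      ?_ ?_ ?_ ?_ ?_ ?_ (-l.1, -l.2.1, -l.2.2) ?_ ?_ ?_ (by omega) (by omega) (by omega)
    · exact fun p hp => (hYm p (Finset.mem_filter.mp hp).1).1
    · exact fun p hp => hXP (Finset.mem_filter.mp hp).1
    · exact fun p hp => (hZm p (Finset.mem_filter.mp hp).1).1
    · exact fun p hp q hq => hXY p (Finset.mem_filter.mp hp).1 q (Finset.mem_filter.mp hq).1
    · exact fun p hp q hq => hYZ p (Finset.mem_filter.mp hp).1 q (Finset.mem_filter.mp hq).1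
    · exact fun p hp q hq => hXZ p (Finset.mem_filter.mp hp).1 q (Finset.mem_filter.mp hq).1
    · intro p hp
      rw [neg]
      have h1 := (Finset.mem_filter.mp hp).2
      have h2 := hYn p (Finset.mem_filter.mp hp).1
      have := lt_of_le_of_ne (not_lt.mp h1) h2
      linarith
    · intro p hp
      rw [neg]
      linarith [(Finset.mem_filter.mp hp).2]
    · intro p hp
      rw [neg]
      linarith [(Finset.mem_filter.mp hp).2]

/-- A horizontal shear. -/
def shear (δ : ℝ) (p : ℝ × ℝ) : ℝ × ℝ := (p.1 + δ * p.2, p.2)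

theorem orient_shear (δ : ℝ) (p q r : ℝ × ℝ) :
    orient (shear δ p) (shear δ q) (shear δ r) = orient p q r := by
  simp only [orient, shear]; ring

theorem shear_inj (δ : ℝ) : Function.Injective (shear δ) := by
  intro p q h
  simp only [shear, Prod.mk.injEq] at h
  obtain ⟨h1, h2⟩ := h
  rw [h2] at h1
  exact Prod.ext (by linarith) h2

theorem orient_of_collinear {p q r : ℝ × ℝ} (h : Collinear ℝ {p, q, r}) : orient p q r = 0 := by
  rw [collinear_iff_of_mem (p₀ := p) (by simp)] at h
  obtain ⟨v, hv⟩ := h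
  obtain ⟨s, hs⟩ := hv q (by simp)
  obtain ⟨t, ht⟩ := hv r (by simp)
  rw [hs, ht]
  simp only [orient, vadd_eq_add, Prod.fst_add, Prod.snd_add, Prod.smul_fst, Prod.smul_snd, smul_eq_mul]
  ring

theorem genPos_shear {P : Finset (ℝ × ℝ)} (hg : GenPos (P : Set (ℝ × ℝ))) (δ : ℝ) [DecidableEq (ℝ × ℝ)] :
    GenPos ((P.image (shear δ) : Finset (ℝ × ℝ)) : Set (ℝ × ℝ)) := by
  intro p hp q hq r hr h1 h2 h3 hcol
  obtain ⟨p', hp', rfl⟩ := Finset.mem_image.mp (Finset.mem_coe.mp hp)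
  obtain ⟨q', hq', rfl⟩ := Finset.mem_image.mp (Finset.mem_coe.mp hq)
  obtain ⟨r', hr', rfl⟩ := Finset.mem_image.mp (Finset.mem_coe.mp hr)
  have := orient_of_collinear hcol
  rw [orient_shear] at this
  exact orient_ne_zero hg hp' hq' hr' (fun h => h1 (by rw [h])) (fun h => h2 (by rw [h]))
    (fun h => h3 (by rw [h])) this

theorem exists_shear (P : Finset (ℝ × ℝ)) : ∃ δ : ℝ, ∀ p ∈ P, ∀ q ∈ P,
    p.1 + δ * p.2 = q.1 + δ * q.2 → p = q := by
  classical
  obtain ⟨δ, hδ⟩ := Infinite.exists_notMem_finset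
    ((P ×ˢ P).image (fun z : (ℝ × ℝ) × (ℝ × ℝ) => (z.2.1 - z.1.1) / (z.1.2 - z.2.2)))
  refine ⟨δ, ?_⟩
  intro p hp q hq h
  by_cases h2 : p.2 = q.2
  · rw [h2] at h
    exact Prod.ext (by linarith) h2
  · exfalso
    apply hδ
    refine Finset.mem_image.mpr ⟨(p, q), Finset.mem_product.mpr ⟨hp, hq⟩, ?_⟩
    have : p.2 - q.2 ≠ 0 := sub_ne_zero.mpr h2
    simp only
    field_simp
    linarith

theorem spokes_unshear {P : Finset (ℝ × ℝ)} (δ : ℝ) (k : ℕ) [DecidableEq (ℝ × ℝ)]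
    (h : Spokes (P.image (shear δ)) k) : Spokes P k := by
  obtain ⟨f, a, b, ha, hb, h1, h2, h3⟩ := h
  have ha' : ∀ i, ∃ p ∈ P, shear δ p = a i := fun i => Finset.mem_image.mp (ha i)
  have hb' : ∀ i, ∃ p ∈ P, shear δ p = b i := fun i => Finset.mem_image.mp (hb i)
  choose a' haP ea using ha'
  choose b' hbP eb using hb'
  have sv : ∀ (l : ℝ × ℝ × ℝ) (p : ℝ × ℝ),
      sideVal (l.1, l.1 * δ + l.2.1, l.2.2) p = sideVal l (shear δ p) := by
    intro l p
    simp only [sideVal, shear]; ring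
  refine ⟨fun i => ((f i).1, (f i).1 * δ + (f i).2.1, (f i).2.2), a', b', haP, hbP, ?_, ?_, ?_⟩
  · intro i
    rw [sv, ea]; exact h1 i
  · intro i
    rw [sv, eb]; exact h2 i
  · intro i j hij
    have := h3 i j hij
    unfold PairOK at this ⊢
    simp only [sv, ea, eb]
    exact this

theorem spokes_one {P : Finset (ℝ × ℝ)} (h : 2 ≤ P.card) : Spokes P 1 := by
  obtain ⟨a, ha, b, hb, hab⟩ := Finset.one_lt_card.mp h
  refine ⟨fun _ => (b.1 - a.1, b.2 - a.2, (b.1 - a.1) * b.1 + (b.2 - a.2) * b.2), fun _ => a, fun _ => b,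
    fun _ => ha, fun _ => hb, ?_, ?_, ?_⟩
  · intro _
    have : 0 < (b.1 - a.1) * (b.1 - a.1) + (b.2 - a.2) * (b.2 - a.2) := by
      by_contra hc
      apply hab
      have e1 : b.1 - a.1 = 0 := by nlinarith [mul_self_nonneg (b.1 - a.1), mul_self_nonneg (b.2 - a.2)]
      have e2 : b.2 - a.2 = 0 := by nlinarith [mul_self_nonneg (b.1 - a.1), mul_self_nonneg (b.2 - a.2)]
      exact Prod.ext (by linarith) (by linarith)
    simp only [sideVal]
    linarith
  · intro _
    simp only [sideVal]
    linarith
  · intro i j hij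
    exact absurd (Subsingleton.elim i j) hij

theorem exists_spokes {P : Finset (ℝ × ℝ)} (hg : GenPos (P : Set (ℝ × ℝ))) (h : 2 ≤ P.card) :
    ∃ k, P.card ≤ 8 * (k * k) ∧ Spokes P k := by
  classical
  by_cases h8 : P.card ≤ 8
  · exact ⟨1, by omega, spokes_one h⟩
  set K := Nat.sqrt ((P.card - 1) / 8) with hKd
  have hK : 1 ≤ K := by
    rw [hKd, Nat.le_sqrt]
    omega
  have h1 : K * K ≤ (P.card - 1) / 8 := Nat.sqrt_le _
  have h2 : (P.card - 1) / 8 < (K + 1) * (K + 1) := Nat.lt_succ_sqrt _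
  refine ⟨K + 1, by omega, ?_⟩
  obtain ⟨δ, hδ⟩ := exists_shear P
  apply spokes_unshear δ
  apply spokes_of_good
  apply good_of_inj hK (genPos_shear hg δ)
  · intro p hp q hq hpq
    obtain ⟨p', hp', rfl⟩ := Finset.mem_image.mp (Finset.mem_coe.mp hp)
    obtain ⟨q', hq', rfl⟩ := Finset.mem_image.mp (Finset.mem_coe.mp hq)
    rw [hδ p' hp' q' hq' hpq]
  · rw [Finset.card_image_of_injective _ (shear_inj δ)]
    omega

theorem stmt16 (n : ℕ) (P : Finset (ℝ × ℝ)) (hP : P.card = n)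
    (hgp : GenPos (P : Set (ℝ × ℝ))) :
    (∀ k : ℕ, ∀ S : Finset (ℝ × ℝ × ℝ), SpokeSet P S → S.card = k →
      ∃ T : Finset (Finset ((ℝ × ℝ) × (ℝ × ℝ))),
        T.card = n - k ∧ CoversCompleteGraph P T) ∧
    ∃ T : Finset (Finset ((ℝ × ℝ) × (ℝ × ℝ))),
      (T.card : ℝ) ≤ (n : ℝ) - Real.sqrt ((n : ℝ) / 8) ∧
      CoversCompleteGraph P T := by
  constructor
  · intro k S hS hk
    subst hP hk
    exact part_one hgp hS
  · by_cases h2 : 2 ≤ P.card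
    · obtain ⟨k, hk, f, a, b, ha, hb, h1, h2, h3⟩ := exists_spokes hgp h2
      obtain ⟨hle, T, hT, hcov⟩ := cover_of_spokes hgp f a b ha hb h1 h2 h3
      rw [Fintype.card_fin] at hle hT
      refine ⟨T, ?_, hcov⟩
      rw [hP] at hle hT hk
      have e1 : (T.card : ℝ) + k ≤ n := by
        have : T.card + k ≤ n := by omega
        exact_mod_cast this
      have e2 : Real.sqrt ((n : ℝ) / 8) ≤ k := by
        rw [Real.sqrt_le_left (Nat.cast_nonneg k)]
        have : (n : ℝ) ≤ 8 * (k * k) := by exact_mod_cast hk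
        rw [pow_two]
        linarith
      linarith
    · refine ⟨∅, ?_, by simp, ?_⟩
      · have hn : n = 0 ∨ n = 1 := by omega
        rcases hn with rfl | rfl
        · simp
        · have : Real.sqrt ((1 : ℕ) / 8 : ℝ) ≤ 1 := by
            rw [Real.sqrt_le_left zero_le_one]
            norm_num
          simp only [Finset.card_empty, Nat.cast_zero]
          simp only [Nat.cast_one] at this ⊢
          linarith
      · intro p hp q hq hpq
        exact absurd (Finset.card_le_one.mp (by omega) p hp q hq) hpq
end

section
/- There exist point sets P of n points in general position (for suitable n) that do not admit a spoke set of size larger than (9/20)n. -/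
/-- Any generic direction determines an unbounded cell, which contains a point of `P`. -/
lemma spoke_point (P : Finset (ℝ × ℝ)) (S : Finset (ℝ × ℝ × ℝ)) (h : SpokeSet P S)
    (u : ℝ × ℝ) (hu : u ≠ 0) (hg : ∀ l ∈ S, l.1 * u.1 + l.2.1 * u.2 ≠ 0) :
    ∃ p ∈ P, ∀ l ∈ S, 0 < sideVal l p * (l.1 * u.1 + l.2.1 * u.2) := by
  have hcont : ∀ l : ℝ × ℝ × ℝ, Continuous (fun x : ℝ × ℝ => sideVal l x) := by
    intro l; unfold sideVal; fun_prop
  have hev : ∀ᶠ T : ℝ in Filter.atTop, ∀ l ∈ S,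
      0 < sideVal l (T • u) * (l.1 * u.1 + l.2.1 * u.2) := by
    rw [Filter.eventually_all_finset]
    intro l hl
    have hd := hg l hl
    set d := l.1 * u.1 + l.2.1 * u.2 with hdd
    have hd2 : 0 < d ^ 2 := by positivity
    filter_upwards [Filter.eventually_gt_atTop (l.2.2 * d / d ^ 2)] with T hT
    rw [div_lt_iff₀ hd2] at hT
    have : sideVal l (T • u) * d = T * d ^ 2 - l.2.2 * d := by
      simp only [sideVal, Prod.smul_fst, Prod.smul_snd, smul_eq_mul, hdd]; ring
    rw [this]; linarith
  obtain ⟨T₀, hT₀⟩ := Filter.eventually_atTop.1 hev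
  set K : Set (ℝ × ℝ) := {x | ∀ l ∈ S, 0 < sideVal l x * (l.1 * u.1 + l.2.1 * u.2)} with hK
  have hKsub : K ⊆ (linesUnion S)ᶜ := by
    intro x hx hmem
    simp only [linesUnion, Set.mem_iUnion] at hmem
    obtain ⟨l, hl, hxl⟩ := hmem
    have h1 := hx l hl
    have h2 : sideVal l x = 0 := by
      simp only [lineOf, Set.mem_ofPred_eq] at hxl
      simp only [sideVal]; linarith
    rw [h2] at h1; simp at h1
  have hKconv : Convex ℝ K := by
    intro x hx y hy a b ha hb hab l hl
    have h1 := hx l hl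
    have h2 := hy l hl
    have : sideVal l (a • x + b • y) = a * sideVal l x + b * sideVal l y := by
      simp only [sideVal, Prod.fst_add, Prod.snd_add, Prod.smul_fst, Prod.smul_snd, smul_eq_mul]
      linear_combination l.2.2 * hab
    rw [this]
    rcases eq_or_lt_of_le ha with h0 | h0
    · have : b = 1 := by linarith
      subst this; rw [← h0]; simpa using h2
    · nlinarith [mul_pos h0 h1, mul_nonneg hb h2.le]
  have hq : T₀ • u ∈ K := hT₀ T₀ le_rfl
  set U := connectedComponentIn (linesUnion S)ᶜ (T₀ • u) with hU
  have hKU : K ⊆ U := hKconv.isPreconnected.subset_connectedComponentIn hq hKsub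
  have hUK : U ⊆ K := by
    intro p hp l hl
    by_contra hneg
    push Not at hneg
    have hpre : IsPreconnected U := isPreconnected_connectedComponentIn
    have hqU : T₀ • u ∈ U := hKU hq
    have := hpre.intermediate_value hp hqU
      (f := fun x => sideVal l x * (l.1 * u.1 + l.2.1 * u.2))
      ((hcont l).mul continuous_const).continuousOn
    obtain ⟨z, hz, hz0⟩ := this ⟨hneg, (hq l hl).le⟩
    have hz' : z ∈ (linesUnion S)ᶜ := connectedComponentIn_subset _ _ hz
    apply hz'
    simp only [linesUnion, Set.mem_iUnion]
    refine ⟨l, hl, ?_⟩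
    have h0 : sideVal l z = 0 := by
      rcases mul_eq_zero.1 hz0 with h | h
      · exact h
      · exact absurd h (hg l hl)
    simp only [sideVal] at h0
    simp only [lineOf, Set.mem_ofPred_eq]; linarith
  have hunb : ¬ Bornology.IsBounded U := by
    intro hb
    obtain ⟨C, hC⟩ := (hb.subset hKU).exists_norm_le
    have hn : 0 < ‖u‖ := norm_pos_iff.2 hu
    set T := max T₀ ((|C| + 1) / ‖u‖) with hT
    have h1 := hC (T • u) (hT₀ T (le_max_left _ _))
    have h2 : (|C| + 1) / ‖u‖ ≤ T := le_max_right _ _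
    rw [div_le_iff₀ hn] at h2
    rw [norm_smul, Real.norm_eq_abs] at h1
    nlinarith [le_abs_self T, le_abs_self C]
  obtain ⟨p, hp, hpU⟩ := h.2.2 U ⟨⟨_, hKsub hq, hU⟩, hunb⟩
  exact ⟨p, hp, hUK hpU⟩

/-- Sorting a finite set of reals, together with interlacing values. -/
lemma exists_interlace (T : Finset ℝ) :
    ∃ s t : ℕ → ℝ, (∀ i < T.card, s i ∈ T) ∧ (∀ x ∈ T, ∃ i < T.card, s i = x) ∧
      ∀ i < T.card, ∀ j < T.card, (j ≤ i → s j < t i) ∧ (i < j → t i < s j) := by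
  classical
  set e := T.orderEmbOfFin rfl with he
  set s : ℕ → ℝ := fun i => if h : i < T.card then e ⟨i, h⟩ else 0 with hs
  have hmono : ∀ i < T.card, ∀ j < T.card, i < j → s i < s j := by
    intro i hi j hj hij
    simp only [hs, hi, hj, dif_pos]
    exact e.strictMono hij
  refine ⟨s, fun i => if i + 1 < T.card then (s i + s (i + 1)) / 2 else s i + 1, ?_, ?_, ?_⟩
  · intro i hi
    simp only [hs, hi, dif_pos]
    exact Finset.orderEmbOfFin_mem T rfl _
  · intro x hx
    have : x ∈ Set.range e := by rw [Finset.range_orderEmbOfFin]; exact hx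
    obtain ⟨i, rfl⟩ := this
    exact ⟨i, i.2, by simp [hs]⟩
  · intro i hi j hj
    have hle : ∀ a < T.card, ∀ b < T.card, a ≤ b → s a ≤ s b := by
      intro a ha b hb hab
      rcases eq_or_lt_of_le hab with h | h
      · rw [h]
      · exact (hmono a ha b hb h).le
    constructor
    · intro hji
      have h1 := hle j hj i hi hji
      dsimp only
      split_ifs with h
      · have := hmono i hi (i + 1) h (by omega)
        linarith
      · linarith
    · intro hij
      have h : i + 1 < T.card := by omega
      have h1 := hle (i + 1) h j hj (by omega)
      have := hmono i hi (i + 1) h (by omega)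
      simp only [h, if_true]
      linarith

lemma fin3_third : ∀ y z : Fin 3, ¬ y = z →
    ∃ w : Fin 3, ∀ v : Fin 3, v ≠ z → v ≠ y → v = w := by decide

lemma fin3_rest : ∀ z : Fin 3, ∃ y w : Fin 3, ∀ v : Fin 3, v ≠ z → v = y ∨ v = w := by decide

/-- The combinatorial core: a three-colouring of `2k-1` points in which every window of
length `k` misses a colour forces a colour class with at least `k-1` points. -/
lemma window_lemma (k m : ℕ) (hk : m + 2 ≤ k) (c : ℕ → Fin 3)
    (hc : ∀ z, ∀ T : Finset ℕ, (∀ i ∈ T, i < 2 * k - 1 ∧ c i = z) → T.card ≤ m)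
    (hw : ∀ t < k, ∃ z, ∀ i < k, c (t + i) ≠ z) : False := by
  obtain ⟨z, hz⟩ := hw 0 (by omega)
  have key : ∀ t < k, ∀ i < k, c (t + i) ≠ z := by
    intro t
    induction t with
    | zero => intro _; exact hz
    | succ t ih =>
      intro ht
      have h1 := ih (by omega)
      obtain ⟨y, hy⟩ := hw (t + 1) ht
      by_cases hyz : y = z
      · subst hyz; exact hy
      · exfalso
        obtain ⟨w, hw'⟩ : ∃ w : Fin 3, ∀ v : Fin 3, v ≠ z → v ≠ y → v = w := by
          exact fin3_third y z hyz
        have := hc w (Finset.Ico (t + 1) (t + k)) (by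
          intro i hi
          rw [Finset.mem_Ico] at hi
          refine ⟨by omega, hw' _ ?_ ?_⟩
          · have := h1 (i - t) (by omega)
            rwa [show t + (i - t) = i by omega] at this
          · have := hy (i - (t + 1)) (by omega)
            rwa [show t + 1 + (i - (t + 1)) = i by omega] at this)
        rw [Nat.card_Ico] at this
        omega
  have hall : ∀ i < 2 * k - 1, c i ≠ z := by
    intro i hi
    by_cases h : i < k
    · have := key 0 (by omega) i h
      rwa [zero_add] at this
    · have := key (i - (k - 1)) (by omega) (k - 1) (by omega)
      rwa [show i - (k - 1) + (k - 1) = i by omega] at this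
  obtain ⟨y, w, hyw⟩ : ∃ y w : Fin 3, ∀ v : Fin 3, v ≠ z → v = y ∨ v = w := by
    exact fin3_rest z
  have h1 := hc y ((Finset.range (2 * k - 1)).filter (fun i => c i = y)) (by
    intro i hi; simpa using hi)
  have h2 := hc w ((Finset.range (2 * k - 1)).filter (fun i => c i = w)) (by
    intro i hi; simpa using hi)
  have h3 : Finset.range (2 * k - 1) ⊆ ((Finset.range (2 * k - 1)).filter (fun i => c i = y)) ∪
      ((Finset.range (2 * k - 1)).filter (fun i => c i = w)) := by
    intro i hi
    have := hyw (c i) (hall i (Finset.mem_range.1 hi))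
    simp only [Finset.mem_union, Finset.mem_filter]
    tauto
  have h4 := (Finset.card_le_card h3).trans (Finset.card_union_le _ _)
  rw [Finset.card_range] at h4
  omega

/-- On the cubic curve, an inner point of the first arm lies in the triangle spanned by an outer
point of this arm and one point of each of the other two classes. -/
lemma cubic_inner (α β γ a a' b c : ℝ) (ha' : 0 < a') (haa : a' < a) (ha : a ≤ 1 / 4)
    (hb : b ≤ -1) (hb' : -(5 / 4) ≤ b) (hc : 3 ≤ c)
    (h1 : 0 < α * a + β * a ^ 3 - γ) (h2 : 0 < α * b + β * b ^ 3 - γ)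
    (h3 : 0 < α * c + β * c ^ 3 - γ) : 0 < α * a' + β * a' ^ 3 - γ := by
  have w0 : 0 < (a - b) * (c - b) * (c - a) * (a + b + c) :=
    mul_pos (mul_pos (mul_pos (by linarith) (by linarith)) (by linarith)) (by linarith)
  have wa : 0 < (a' - b) * (c - b) * (c - a') * (a' + b + c) :=
    mul_pos (mul_pos (mul_pos (by linarith) (by linarith)) (by linarith)) (by linarith)
  have wb : 0 < (a - a') * (c - a') * (c - a) * (a + a' + c) :=
    mul_pos (mul_pos (mul_pos (by linarith) (by linarith)) (by linarith)) (by linarith)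
  have wc : 0 < (a - b) * (a' - b) * (a - a') * (-(a + b + a')) :=
    mul_pos (mul_pos (mul_pos (by linarith) (by linarith)) (by linarith)) (by linarith)
  have key : (α * a' + β * a' ^ 3 - γ) * ((a - b) * (c - b) * (c - a) * (a + b + c)) =
      (α * a + β * a ^ 3 - γ) * ((a' - b) * (c - b) * (c - a') * (a' + b + c)) +
      (α * b + β * b ^ 3 - γ) * ((a - a') * (c - a') * (c - a) * (a + a' + c)) +
      (α * c + β * c ^ 3 - γ) * ((a - b) * (a' - b) * (a - a') * (-(a + b + a'))) := by
    ring
  have : 0 < (α * a' + β * a' ^ 3 - γ) * ((a - b) * (c - b) * (c - a) * (a + b + c)) := by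
    rw [key]; positivity
  exact pos_of_mul_pos_left this w0.le

/-- Collinear points on the cubic have abscissae with sum zero. -/
lemma cubic_collinear (x y z : ℝ) (hxy : x ≠ y) (hxz : x ≠ z) (hyz : y ≠ z)
    (h : Collinear ℝ {((x, x ^ 3) : ℝ × ℝ), (y, y ^ 3), (z, z ^ 3)}) : x + y + z = 0 := by
  rw [collinear_iff_of_mem (p₀ := ((x, x ^ 3) : ℝ × ℝ)) (by simp)] at h
  obtain ⟨v, hv⟩ := h
  obtain ⟨r, hr⟩ := hv (y, y ^ 3) (by simp)
  obtain ⟨q, hq⟩ := hv (z, z ^ 3) (by simp)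
  simp only [vadd_eq_add, Prod.ext_iff, Prod.fst_add, Prod.snd_add, Prod.smul_fst,
    Prod.smul_snd, smul_eq_mul] at hr hq
  obtain ⟨r1, r2⟩ := hr
  obtain ⟨q1, q2⟩ := hq
  have e1 : y - x = r * v.1 := by linarith
  have e2 : y ^ 3 - x ^ 3 = r * v.2 := by linarith
  have e3 : z - x = q * v.1 := by linarith
  have e4 : z ^ 3 - x ^ 3 = q * v.2 := by linarith
  have : (y - x) * (z - x) * (z - y) * (x + y + z) = 0 := by
    have : (y - x) * (z - x) * (z - y) * (x + y + z) =
      (y - x) * (z ^ 3 - x ^ 3) - (z - x) * (y ^ 3 - x ^ 3) := by ring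
    rw [this, e1, e2, e3, e4]; ring
  have h1 : y - x ≠ 0 := sub_ne_zero.2 hxy.symm
  have h2 : z - x ≠ 0 := sub_ne_zero.2 hxz.symm
  have h3 : z - y ≠ 0 := sub_ne_zero.2 hyz.symm
  simpa [h1, h2, h3] using this

/-- The cyclic sequence of points and oriented lines obtained from a spoke set. -/
lemma spoke_sequence (P : Finset (ℝ × ℝ)) (S : Finset (ℝ × ℝ × ℝ)) (h : SpokeSet P S) :
    ∃ k : ℕ, S.card ≤ k + 1 ∧ (0 < k → ∃ (p : ℕ → ℝ × ℝ) (F : ℕ → ℝ × ℝ × ℝ),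
      (∀ i, p i ∈ P) ∧
      (∀ i j, j ≤ i → i < j + k → 0 < sideVal (F j) (p i)) ∧
      (∀ i j, j + k ≤ i → i < j + 2 * k → sideVal (F j) (p i) < 0) ∧
      (∀ i j, i < j → j ≤ i + k → sideVal (F j) (p i) < 0)) := by
  classical
  set S' := S.filter (fun l => l.2.1 ≠ 0) with hS'
  set sl : ℝ × ℝ × ℝ → ℝ := fun l => -l.1 / l.2.1 with hsl
  have hinj : Set.InjOn sl S' := by
    intro l hl m hm hlm
    simp only [hS', Finset.coe_filter, Set.mem_ofPred_eq] at hl hm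
    by_contra hne
    apply h.2.1 l hl.1 m hm.1 hne
    simp only [hsl] at hlm
    rw [div_eq_div_iff hl.2 hm.2] at hlm
    linarith
  set T := S'.image sl with hT
  have hTc : T.card = S'.card := Finset.card_image_of_injOn hinj
  have hcard : S.card ≤ T.card + 1 := by
    have h1 : (S.filter (fun l => l.2.1 ≠ 0)).card + (S.filter (fun l => ¬ l.2.1 ≠ 0)).card
        = S.card := Finset.card_filter_add_card_filter_not _
    have h2 : (S.filter (fun l => ¬ l.2.1 ≠ 0)).card ≤ 1 := by
      rw [Finset.card_le_one]
      intro l hl m hm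
      simp only [Finset.mem_filter, not_not] at hl hm
      by_contra hne
      apply h.2.1 l hl.1 m hm.1 hne
      rw [hl.2, hm.2]; ring
    have h3 : S'.card = (S.filter (fun l => l.2.1 ≠ 0)).card := rfl
    omega
  refine ⟨T.card, hcard, fun hk => ?_⟩
  obtain ⟨s, t, hs, hs', hst⟩ := exists_interlace T
  set k := T.card with hkdef
  have hline : ∀ i, ∃ l, i < k → l ∈ S' ∧ sl l = s i := by
    intro i
    by_cases hi : i < k
    · obtain ⟨l, hl, hls⟩ := Finset.mem_image.1 (hs i hi)
      exact ⟨l, fun _ => ⟨hl, hls⟩⟩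
    · exact ⟨0, fun h => absurd h hi⟩
  choose f hf using hline
  -- oriented normalised lines
  have hpt : ∀ i, ∃ p ∈ P, ∀ j < k,
      0 < (sideVal (f j) p / (f j).2.1) * ((-1 : ℝ) ^ (i / k) * (t (i % k) - s j)) := by
    intro i
    have hi : i % k < k := Nat.mod_lt _ hk
    have hsgn : ((-1 : ℝ) ^ (i / k)) ≠ 0 := by positivity
    obtain ⟨p, hp, hpl⟩ := spoke_point P S h ((-1 : ℝ) ^ (i / k), (-1 : ℝ) ^ (i / k) * t (i % k))
      (by intro h0; exact hsgn (congrArg Prod.fst h0)) (by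
        intro l hl h0
        have h0' : (-1 : ℝ) ^ (i / k) * (l.1 + l.2.1 * t (i % k)) = 0 := by
          dsimp only at h0; linarith
        have h1 := (mul_eq_zero.1 h0').resolve_left hsgn
        by_cases hv : l.2.1 = 0
        · rw [hv] at h1
          apply h.1 l hl
          rw [hv, show l.1 = 0 by linarith]
        · have hlT : sl l ∈ T := Finset.mem_image_of_mem _ (Finset.mem_filter.2 ⟨hl, hv⟩)
          obtain ⟨j, hj, hjl⟩ := hs' _ hlT
          have : s j = t (i % k) := by
            rw [hjl]; simp only [hsl]; rw [div_eq_iff hv]; linarith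
          have h2 := hst (i % k) hi j hj
          rcases Nat.lt_or_ge (i % k) j with h3 | h3
          · linarith [h2.2 h3]
          · linarith [h2.1 h3])
    refine ⟨p, hp, fun j hj => ?_⟩
    obtain ⟨hfS, hfs⟩ := hf j hj
    rw [hS', Finset.mem_filter] at hfS
    have h1 := hpl (f j) hfS.1
    have hb := hfS.2
    have ha : (f j).1 = - s j * (f j).2.1 := by
      rw [← hfs]; simp only [hsl]; field_simp
    have h2 : sideVal (f j) p / (f j).2.1 * ((-1 : ℝ) ^ (i / k) * (t (i % k) - s j)) =
        (sideVal (f j) p * ((f j).1 * (-1 : ℝ) ^ (i / k) +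
          (f j).2.1 * ((-1 : ℝ) ^ (i / k) * t (i % k)))) / (f j).2.1 ^ 2 := by
      rw [ha]; field_simp; ring
    rw [h2]
    exact div_pos h1 (by positivity)
  choose p hpP hp using hpt
  set F : ℕ → ℝ × ℝ × ℝ := fun j => ((-1 : ℝ) ^ (j / k) / (f (j % k)).2.1) • f (j % k) with hF
  have hFv : ∀ i j, 0 < sideVal (F j) (p i) *
      ((-1 : ℝ) ^ (j / k) * (-1 : ℝ) ^ (i / k) * (t (i % k) - s (j % k))) := by
    intro i j
    have h1 := hp i (j % k) (Nat.mod_lt _ hk)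
    have h2 : sideVal (F j) (p i) = (-1 : ℝ) ^ (j / k) *
        (sideVal (f (j % k)) (p i) / (f (j % k)).2.1) := by
      simp only [hF, sideVal, Prod.smul_fst, Prod.smul_snd, smul_eq_mul]; ring
    have h3 : ((-1 : ℝ) ^ (j / k)) * ((-1 : ℝ) ^ (j / k)) = 1 := by
      rw [← mul_pow]; simp
    rw [h2]
    calc (0:ℝ) < _ := h1
      _ = ((-1 : ℝ) ^ (j / k)) * ((-1 : ℝ) ^ (j / k)) * (sideVal (f (j % k)) (p i) / (f (j % k)).2.1 * ((-1 : ℝ) ^ (i / k) * (t (i % k) - s (j % k)))) := by rw [h3, one_mul]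
      _ = _ := by ring
  have hpos : ∀ i j, j ≤ i → i < j + k → 0 < sideVal (F j) (p i) := by
    intro i j hji hij
    have h0 := hFv i j
    have hi := Nat.mod_lt i hk
    have hj := Nat.mod_lt j hk
    have hsq : ((-1 : ℝ) ^ (j / k)) * ((-1 : ℝ) ^ (j / k)) = 1 := by
      rw [← mul_pow]; simp
    have hst' := hst (i % k) hi (j % k) hj
    have e1 := Nat.div_add_mod i k
    have e2 := Nat.div_add_mod j k
    have hd1 : j / k ≤ i / k := Nat.div_le_div_right hji
    have hd2 : i / k ≤ j / k + 1 := by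
      have := Nat.div_le_div_right (c := k) hij.le
      rwa [Nat.add_div_right _ hk] at this
    rcases (show i / k = j / k ∨ i / k = j / k + 1 by omega) with h1 | h1
    · rw [h1] at e1 h0
      rw [hsq, one_mul] at h0
      exact pos_of_mul_pos_left h0 (by linarith [hst'.1 (by omega)])
    · rw [h1] at e1 h0
      rw [Nat.mul_add, Nat.mul_one] at e1
      rw [pow_succ, ← mul_assoc ((-1 : ℝ) ^ (j / k)), hsq] at h0
      exact pos_of_mul_pos_left h0 (by linarith [hst'.2 (by omega)])
  have hneg : ∀ i j, sideVal (F (j + k)) (p i) = - sideVal (F j) (p i) := by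
    intro i j
    simp only [hF, Nat.add_mod_right, Nat.add_div_right _ hk, sideVal, Prod.smul_fst,
      Prod.smul_snd, smul_eq_mul, pow_succ]
    ring
  have hneg1 : ∀ i j, j + k ≤ i → i < j + 2 * k → sideVal (F j) (p i) < 0 := by
    intro i j h1 h2
    have := hpos i (j + k) h1 (by omega)
    rw [hneg] at this; linarith
  refine ⟨p, F, hpP, hpos, hneg1, ?_⟩
  intro i j h1 h2
  by_cases hjk : k ≤ j
  · have := hpos i (j - k) (by omega) (by omega)
    have h3 := hneg i (j - k)
    rw [Nat.sub_add_cancel hjk] at h3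
    linarith
  · -- here both indices are below `k`
    have h0 := hFv i j
    have hj : j < k := by omega
    have hi : i < k := by omega
    rw [Nat.div_eq_of_lt hj, Nat.div_eq_of_lt hi, Nat.mod_eq_of_lt hj, Nat.mod_eq_of_lt hi] at h0
    have := (hst i hi j hj).2 h1
    simp only [pow_zero, one_mul] at h0
    by_contra hcon
    push Not at hcon
    nlinarith

/-- The combination of everything for a set on the cubic curve. -/
lemma cubic_spoke_bound (m : ℕ) (hm : 1 ≤ m) (A B C : Finset ℝ) (hA : A.card = m)
    (hB : B.card = m) (hC : C.card = m) (hA' : ∀ x ∈ A, 0 < x ∧ x ≤ 1 / 4)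
    (hB' : ∀ x ∈ B, -(5 / 4) ≤ x ∧ x ≤ -1) (hC' : ∀ x ∈ C, 3 ≤ x)
    (S : Finset (ℝ × ℝ × ℝ))
    (h : SpokeSet ((A ∪ B ∪ C).image (fun x => ((x, x ^ 3) : ℝ × ℝ))) S) :
    S.card ≤ m + 2 := by
  classical
  obtain ⟨k, hSk, hseq⟩ := spoke_sequence _ S h
  by_contra hcon
  push Not at hcon
  have hk : m + 2 ≤ k := by omega
  obtain ⟨p, F, hpP, hpos, hneg1, hneg2⟩ := hseq (by omega)
  have hpx : ∀ i, ∃ x ∈ A ∪ B ∪ C, (x, x ^ 3) = p i := fun i => Finset.mem_image.1 (hpP i)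
  choose x hxm hx using hpx
  have hxinj : ∀ i i', i < i' → i' < i + 2 * k → x i ≠ x i' := by
    intro i i' h1 h2 heq
    have hpp : p i = p i' := by rw [← hx, ← hx, heq]
    by_cases h3 : i' ≤ i + k
    · have a1 := hneg2 i (i + 1) (by omega) (by omega)
      have a2 := hpos i' (i + 1) (by omega) (by omega)
      rw [hpp] at a1; linarith
    · have a1 := hpos i i (by omega) (by omega)
      have a2 := hneg1 i' i (by omega) (by omega)
      rw [hpp] at a1; linarith
  -- some point of the sequence lies in `A`
  have hexA : ∃ i, x i ∈ A := by
    by_contra hno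
    push Not at hno
    have h1 : (Finset.range (2 * k)).card ≤ (B ∪ C).card := by
      apply Finset.card_le_card_of_injOn x
      · intro i _
        have := hxm i
        have h2 := hno i
        simp only [Finset.mem_union, Finset.coe_union, Set.mem_union, Finset.mem_coe] at this ⊢
        tauto
      · intro i hi i' hi' heq
        simp only [Finset.coe_range, Set.mem_Iio] at hi hi'
        by_contra hne
        rcases lt_or_gt_of_ne hne with h3 | h3
        · exact hxinj i i' h3 (by omega) heq
        · exact hxinj i' i h3 (by omega) heq.symm
    have h2 := Finset.card_union_le B C
    rw [Finset.card_range] at h1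
    omega
  -- the innermost one
  obtain ⟨i₀, hi₀, hmin⟩ : ∃ i₀, x i₀ ∈ A ∧ ∀ i, x i ∈ A → x i₀ ≤ x i := by
    obtain ⟨i₁, hi₁⟩ := hexA
    obtain ⟨a, ha, hamin⟩ := Finset.exists_min_image (A.filter (fun a => ∃ i, x i = a)) id
      ⟨x i₁, Finset.mem_filter.2 ⟨hi₁, i₁, rfl⟩⟩
    obtain ⟨haA, i₀, rfl⟩ := Finset.mem_filter.1 ha
    exact ⟨i₀, haA, fun i hi => hamin (x i) (Finset.mem_filter.2 ⟨hi, i, rfl⟩)⟩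
  set cl : Fin 3 → Finset ℝ := ![A, B, C] with hcl
  have hclc : ∀ z, (cl z).card = m := by
    intro z; fin_cases z <;> simp [hcl, hA, hB, hC]
  have hcol : ∀ i, ∃ z, x (i₀ + 1 + i) ∈ cl z := by
    intro i
    have := hxm (i₀ + 1 + i)
    simp only [Finset.mem_union] at this
    rcases this with (h1 | h1) | h1
    · exact ⟨0, h1⟩
    · exact ⟨1, h1⟩
    · exact ⟨2, h1⟩
  choose c hc using hcol
  refine window_lemma k m hk c ?_ ?_
  · intro z T hT
    rw [← hclc z]
    apply Finset.card_le_card_of_injOn (fun i => x (i₀ + 1 + i))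
    · intro i hi
      have := (hT i hi).2
      rw [← this]; exact hc i
    · intro i hi i' hi' heq
      have h1 := (hT i hi).1
      have h2 := (hT i' hi').1
      by_contra hne
      rcases lt_or_gt_of_ne hne with h3 | h3
      · exact hxinj _ _ (by omega) (by omega) heq
      · exact hxinj (i₀ + 1 + i') (i₀ + 1 + i) (by omega) (by omega) heq.symm
  · intro t ht
    by_contra hno
    push Not at hno
    obtain ⟨ia, hia, ca⟩ := hno 0
    obtain ⟨ib, hib, cb⟩ := hno 1
    obtain ⟨ic, hic, cc⟩ := hno 2
    have ma : x (i₀ + 1 + (t + ia)) ∈ A := by have := hc (t + ia); rwa [ca] at this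
    have mb : x (i₀ + 1 + (t + ib)) ∈ B := by have := hc (t + ib); rwa [cb] at this
    have mc : x (i₀ + 1 + (t + ic)) ∈ C := by have := hc (t + ic); rwa [cc] at this
    have pa := hpos (i₀ + 1 + (t + ia)) (i₀ + 1 + t) (by omega) (by omega)
    have pb := hpos (i₀ + 1 + (t + ib)) (i₀ + 1 + t) (by omega) (by omega)
    have pc := hpos (i₀ + 1 + (t + ic)) (i₀ + 1 + t) (by omega) (by omega)
    have p0 := hneg2 i₀ (i₀ + 1 + t) (by omega) (by omega)
    rw [← hx] at pa pb pc p0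
    have hle := hmin _ ma
    have hlt : x i₀ < x (i₀ + 1 + (t + ia)) := by
      rcases eq_or_lt_of_le hle with h1 | h1
      · rw [← h1] at pa; linarith
      · exact h1
    have := cubic_inner _ _ _ _ _ _ _ (hA' _ hi₀).1 hlt (hA' _ ma).2 (hB' _ mb).2 (hB' _ mb).1
      (hC' _ mc) pa pb pc
    simp only [sideVal] at p0
    linarith

theorem stmt17 : ∀ N : ℕ, ∃ n : ℕ, N ≤ n ∧ ∃ P : Finset (ℝ × ℝ),
    P.card = n ∧ GenPos (P : Set (ℝ × ℝ)) ∧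
    ∀ S : Finset (ℝ × ℝ × ℝ), SpokeSet P S →
      (S.card : ℝ) ≤ 9 / 20 * (n : ℝ) := by
  classical
  intro N
  set m := N + 6 with hm
  set e : ℕ → ℝ := fun i => 1 / (4 * ((i : ℝ) + 1)) with he
  have he0 : ∀ i, 0 < e i := by intro i; simp only [he]; positivity
  have he1 : ∀ i, e i ≤ 1 / 4 := by
    intro i
    simp only [he]
    have : (0 : ℝ) ≤ i := Nat.cast_nonneg i
    apply one_div_le_one_div_of_le (by norm_num); linarith
  have hei : Function.Injective e := by
    intro i j hij
    simp only [he, one_div, inv_inj] at hij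
    have : (i : ℝ) = j := by linarith
    exact_mod_cast this
  set A := (Finset.range m).image e with hA
  set B := (Finset.range m).image (fun i => -1 - e i) with hB
  set C := (Finset.range m).image (fun i => 3 + e i) with hC
  have hAc : A.card = m := by
    rw [hA, Finset.card_image_of_injective _ hei, Finset.card_range]
  have hBc : B.card = m := by
    rw [hB, Finset.card_image_of_injective, Finset.card_range]
    intro i j hij; apply hei; dsimp only at hij; linarith
  have hCc : C.card = m := by
    rw [hC, Finset.card_image_of_injective, Finset.card_range]
    intro i j hij; apply hei; dsimp only at hij; linarith
  have hA' : ∀ x ∈ A, 0 < x ∧ x ≤ 1 / 4 := by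
    intro x hx
    obtain ⟨i, _, rfl⟩ := Finset.mem_image.1 hx
    exact ⟨he0 i, he1 i⟩
  have hB' : ∀ x ∈ B, -(5 / 4) ≤ x ∧ x ≤ -1 := by
    intro x hx
    obtain ⟨i, _, rfl⟩ := Finset.mem_image.1 hx
    constructor <;> linarith [he0 i, he1 i]
  have hC' : ∀ x ∈ C, 3 ≤ x := by
    intro x hx
    obtain ⟨i, _, rfl⟩ := Finset.mem_image.1 hx
    linarith [he0 i]
  have hcur : Function.Injective (fun x : ℝ => ((x, x ^ 3) : ℝ × ℝ)) := by
    intro x y hxy; exact congrArg Prod.fst hxy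
  refine ⟨3 * m, by omega, (A ∪ B ∪ C).image (fun x => ((x, x ^ 3) : ℝ × ℝ)), ?_, ?_, ?_⟩
  · rw [Finset.card_image_of_injective _ hcur, Finset.card_union_of_disjoint,
      Finset.card_union_of_disjoint, hAc, hBc, hCc]
    · ring
    · rw [Finset.disjoint_left]
      intro x h1 h2
      linarith [hA' x h1, hB' x h2]
    · rw [Finset.disjoint_left]
      intro x h1 h2
      have h3 := hC' x h2
      rcases Finset.mem_union.1 h1 with h1 | h1
      · linarith [hA' x h1]
      · linarith [hB' x h1]
  · intro p hp q hq r hr hpq hpr hqr hcol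
    rw [Finset.mem_coe] at hp hq hr
    obtain ⟨x, hx, rfl⟩ := Finset.mem_image.1 hp
    obtain ⟨y, hy, rfl⟩ := Finset.mem_image.1 hq
    obtain ⟨z, hz, rfl⟩ := Finset.mem_image.1 hr
    have hsum := cubic_collinear x y z (fun h => hpq (by rw [h])) (fun h => hpr (by rw [h]))
      (fun h => hqr (by rw [h])) hcol
    have cls : ∀ w ∈ A ∪ B ∪ C, (0 < w ∧ w ≤ 1 / 4) ∨ (-(5 / 4) ≤ w ∧ w ≤ -1) ∨ 3 ≤ w := by
      intro w hw
      simp only [Finset.mem_union] at hw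
      rcases hw with (h1 | h1) | h1
      · exact Or.inl (hA' w h1)
      · exact Or.inr (Or.inl (hB' w h1))
      · exact Or.inr (Or.inr (hC' w h1))
    rcases cls x hx with h1 | h1 | h1 <;> rcases cls y hy with h2 | h2 | h2 <;>
      rcases cls z hz with h3 | h3 | h3 <;> linarith
  · intro S hS
    have h1 := cubic_spoke_bound m (by omega) A B C hAc hBc hCc hA' hB' hC' S hS
    have h2 : (S.card : ℝ) ≤ m + 2 := by exact_mod_cast h1
    have h3 : (6 : ℝ) ≤ m := by exact_mod_cast (show 6 ≤ m by omega)
    push_cast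
    linarith
end
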